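/- arXiv:2002.07612 — 4 statements merged into one kernel-verified Lean document; each statement's English description precedes it below -/
import Mathlib

section
/- For every integer k ≥ 1 and every forest T on at least k+1 vertices, the minimum number of edges that must be added to T (on the same vertex set) so that the resulting graph has minimum degree at least k equals ⌈ df(T)/2 ⌉ = ⌈ (1/2) · ∑_{v ∈ V(T)} max(0, k − deg_T(v)) ⌉. -/
theorem aux_forest_core {V : Type*} [Fintype V] (T : SimpleGraph V) (hT : T.IsAcyclic)
    (W : Set V) (hW : W.Nonempty)
    (h : ∀ x ∈ W, ∃ y ∈ W, ∃ z ∈ W, y ≠ z ∧ T.Adj x y ∧ T.Adj x z) : False := by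
  classical
  obtain ⟨w, hw⟩ := hW
  obtain ⟨y, hy, z, hz, hyz, -, -⟩ := h w hw
  have : Nontrivial W := ⟨⟨y, hy⟩, ⟨z, hz⟩, by simpa using hyz⟩
  have hc : (⊤ : SimpleGraph W).Connected := SimpleGraph.connected_top
  obtain ⟨F, hF⟩ := hc.exists_isTree_le_of_le_of_isAcyclic (H := T.induce W) le_top (hT.induce W)
  obtain ⟨hF1, -, hF2⟩ : T.induce W ≤ F ∧ F ≤ ⊤ ∧ F.IsTree := by tauto
  obtain ⟨v, hv⟩ := hF2.exists_vert_degree_one_of_nontrivial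
  rw [SimpleGraph.degree_eq_one_iff_existsUnique_adj] at hv
  obtain ⟨y, hy, z, hz, hyz, h1, h2⟩ := h v v.2
  have e := hv.unique (hF1 (show (T.induce W).Adj v ⟨y, hy⟩ from h1))
    (hF1 (show (T.induce W).Adj v ⟨z, hz⟩ from h2))
  exact hyz (congrArg Subtype.val e)

open Classical in
/-- admissible partial completions: no vertex exceeds its target degree -/
def AuxGood {V : Type*} [Fintype V] (k : ℕ) (T G : SimpleGraph V) : Prop :=
  T ≤ G ∧ ∀ v, G.degree v ≤ max k (T.degree v)

open Classical in
theorem aux_edge {V : Type*} [Fintype V] (G : SimpleGraph V) (u v : V) (huv : u ≠ v)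
    (hn : ¬ G.Adj u v) : ∃ G' : SimpleGraph V,
      (∀ a b, G'.Adj a b ↔ G.Adj a b ∨ (a = u ∧ b = v ∨ a = v ∧ b = u)) ∧
      G'.edgeFinset.card = G.edgeFinset.card + 1 := by
  refine ⟨G ⊔ SimpleGraph.edge u v, ?_, ?_⟩
  · intro a b
    simp only [SimpleGraph.sup_adj, SimpleGraph.edge_adj]
    grind
  · have := G.card_edgeFinset_sup_edge hn huv
    convert this

open Classical in
theorem aux_del {V : Type*} [Fintype V] (G : SimpleGraph V) (x y : V)
    (hxy : G.Adj x y) : ∃ G1 : SimpleGraph V,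
      (∀ a b, G1.Adj a b ↔ G.Adj a b ∧ ¬ (a = x ∧ b = y ∨ a = y ∧ b = x)) ∧
      G1.edgeFinset.card + 1 = G.edgeFinset.card := by
  obtain ⟨G1, hG1⟩ : ∃ G1, G1 = G.deleteEdges {s(x, y)} := ⟨_, rfl⟩
  refine ⟨G1, ?_, ?_⟩
  · intro a b; simp [hG1, SimpleGraph.deleteEdges_adj]
  · have : G1.edgeFinset = G.edgeFinset.erase s(x, y) := by
      ext e
      simp [hG1, SimpleGraph.edgeSet_deleteEdges, and_comm]
    rw [this, Finset.card_erase_add_one]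
    simpa using hxy

open Classical in
theorem aux_add {V : Type*} [Fintype V] (k : ℕ) (T G : SimpleGraph V)
    (hG : AuxGood k T G)
    (hmax : ∀ G', AuxGood k T G' → G'.edgeFinset.card ≤ G.edgeFinset.card)
    (u v : V) (huv : u ≠ v) (hu : G.degree u < k) (hv : G.degree v < k) : G.Adj u v := by
  by_contra hn
  obtain ⟨G', ha, hc⟩ := aux_edge G u v huv hn
  have := hmax G' ⟨fun a b hab => (ha a b).2 (Or.inl (hG.1 hab)), fun w => ?_⟩
  · omega
  · have hw := hG.2 w
    by_cases h : w = u ∨ w = v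
    · have : G'.neighborFinset w ⊆
          insert (if w = u then v else u) (G.neighborFinset w) := by
        intro x hx
        simp only [SimpleGraph.mem_neighborFinset, ha,
          Finset.mem_insert] at hx ⊢
        grind
      have := (Finset.card_le_card this).trans (Finset.card_insert_le _ _)
      simp only [SimpleGraph.card_neighborFinset_eq_degree] at this
      grind
    · have : G'.neighborFinset w ⊆ G.neighborFinset w := by
        intro x hx
        simp only [SimpleGraph.mem_neighborFinset, ha]
          at hx ⊢
        grind
      have := Finset.card_le_card this
      simp only [SimpleGraph.card_neighborFinset_eq_degree] at this
      omega

open Classical in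
theorem aux_switch {V : Type*} [Fintype V] (k : ℕ) (T G : SimpleGraph V)
    (hG : AuxGood k T G)
    (hmax : ∀ G', AuxGood k T G' → G'.edgeFinset.card ≤ G.edgeFinset.card)
    (u v x y : V) (huv : u = v ∨ G.Adj u v) (hu : G.degree u < k) (hv : G.degree v < k)
    (he : u = v → G.degree u + 2 ≤ k) (hxu : x ≠ u) (hyv : y ≠ v)
    (hx : ¬ G.Adj u x) (hy : ¬ G.Adj v y) (hxy : G.Adj x y) : T.Adj x y := by
  by_contra hT
  have hxv : x ≠ v := by rintro rfl; tauto
  have hyu : y ≠ u := by rintro rfl; have := G.adj_comm x y; have := G.adj_comm v y; grind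
  have hne : x ≠ y := hxy.ne
  obtain ⟨G1, a1, c1⟩ := aux_del G x y hxy
  obtain ⟨G2, a2, c2⟩ := aux_edge G1 u x hxu.symm (by rw [a1]; tauto)
  obtain ⟨G3, a3, c3⟩ := aux_edge G2 v y hyv.symm (by rw [a2, a1]; grind)
  have := hmax G3 ⟨?_, fun w => ?_⟩
  · omega
  · intro a b hab
    rw [a3, a2, a1]
    have := hG.1 hab
    have := T.adj_comm a b
    grind
  · have hw := hG.2 w
    rw [← SimpleGraph.card_neighborFinset_eq_degree]
    have cw := G.card_neighborFinset_eq_degree w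
    by_cases h1 : w = x
    · have : G3.neighborFinset w ⊆ insert u ((G.neighborFinset w).erase y) := by
        intro z hz
        simp only [SimpleGraph.mem_neighborFinset, Finset.mem_insert, Finset.mem_erase, a3, a2, a1]
          at hz ⊢
        grind
      have := (Finset.card_le_card this).trans (Finset.card_insert_le _ _)
      rw [Finset.card_erase_add_one (by simpa [h1] using hxy)] at this
      omega
    by_cases h2 : w = y
    · have : G3.neighborFinset w ⊆ insert v ((G.neighborFinset w).erase x) := by
        intro z hz
        simp only [SimpleGraph.mem_neighborFinset, Finset.mem_insert, Finset.mem_erase, a3, a2, a1]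
          at hz ⊢
        grind
      have := (Finset.card_le_card this).trans (Finset.card_insert_le _ _)
      rw [Finset.card_erase_add_one (by simpa [h2] using hxy.symm)] at this
      omega
    by_cases h3 : w = u ∧ w = v
    · have : G3.neighborFinset w ⊆ insert x (insert y (G.neighborFinset w)) := by
        intro z hz
        simp only [SimpleGraph.mem_neighborFinset, Finset.mem_insert, a3, a2, a1] at hz ⊢
        grind
      have := (Finset.card_le_card this).trans (Finset.card_insert_le _ _)
      have := Finset.card_insert_le y (G.neighborFinset w)
      have := he (h3.1.symm.trans h3.2)
      have : G.degree w = G.degree u := by rw [h3.1]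
      omega
    by_cases h4 : w = u
    · have : G3.neighborFinset w ⊆ insert x (G.neighborFinset w) := by
        intro z hz
        simp only [SimpleGraph.mem_neighborFinset, Finset.mem_insert, a3, a2, a1] at hz ⊢
        grind
      have := (Finset.card_le_card this).trans (Finset.card_insert_le _ _)
      have : G.degree w = G.degree u := by rw [h4]
      omega
    by_cases h5 : w = v
    · have : G3.neighborFinset w ⊆ insert y (G.neighborFinset w) := by
        intro z hz
        simp only [SimpleGraph.mem_neighborFinset, Finset.mem_insert, a3, a2, a1] at hz ⊢
        grind
      have := (Finset.card_le_card this).trans (Finset.card_insert_le _ _)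
      have : G.degree w = G.degree v := by rw [h5]
      omega
    · have : G3.neighborFinset w ⊆ G.neighborFinset w := by
        intro z hz
        simp only [SimpleGraph.mem_neighborFinset, a3, a2, a1] at hz ⊢
        grind
      have := Finset.card_le_card this
      omega

open Classical in
/-- one half of the counting step -/
theorem aux_half {V : Type*} [Fintype V] (k : ℕ) (T G : SimpleGraph V)
    (hG : AuxGood k T G)
    (hmax : ∀ G', AuxGood k T G' → G'.edgeFinset.card ≤ G.edgeFinset.card)
    (u v : V) (huv : u = v ∨ G.Adj u v) (hu : G.degree u < k) (hv : G.degree v < k)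
    (he : u = v → G.degree u + 2 ≤ k) (x : V) (hxu : x ≠ u) (hx : ¬ G.Adj u x) :
    ∃ y, (y ≠ v ∧ ¬ G.Adj v y) ∧ ∃ z, (z ≠ v ∧ ¬ G.Adj v z) ∧ y ≠ z ∧ T.Adj x y ∧ T.Adj x z := by
  have hdx : k ≤ G.degree x := by
    by_contra h
    exact hx (aux_add k T G hG hmax u x hxu.symm hu (by omega))
  set B := (G.neighborFinset x).filter (fun y => y ≠ v ∧ ¬ G.Adj v y) with hB
  set C := (G.neighborFinset x).filter (fun y => ¬ (y ≠ v ∧ ¬ G.Adj v y)) with hC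
  have hBC : B.card + C.card = G.degree x := by
    rw [← SimpleGraph.card_neighborFinset_eq_degree]
    exact Finset.card_filter_add_card_filter_not _
  have cv := G.card_neighborFinset_eq_degree v
  have hCk : C.card + 2 ≤ k := by
    have hs := G.adj_comm x
    have hs2 := G.adj_comm v
    by_cases h : u = v
    · have : C ⊆ G.neighborFinset v := by
        intro z hz
        simp only [hC, Finset.mem_filter, SimpleGraph.mem_neighborFinset] at hz ⊢
        grind
      have := Finset.card_le_card this
      have := he h
      subst h
      omega
    have hA : G.Adj u v := by tauto
    have hmu : u ∈ G.neighborFinset v := by simpa using hA.symm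
    have hm1 := Finset.card_erase_add_one hmu
    by_cases hxv : G.Adj v x
    · have : C ⊆ insert v (((G.neighborFinset v).erase u).erase x) := by
        intro z hz
        simp only [hC, Finset.mem_filter, SimpleGraph.mem_neighborFinset, Finset.mem_insert,
          Finset.mem_erase] at hz ⊢
        have := G.irrefl (v := x)
        grind
      have := (Finset.card_le_card this).trans (Finset.card_insert_le _ _)
      rw [Finset.card_erase_add_one (by simp [hxu, hxv])] at this
      omega
    · have : C ⊆ (G.neighborFinset v).erase u := by
        intro z hz
        simp only [hC, Finset.mem_filter, SimpleGraph.mem_neighborFinset,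
          Finset.mem_erase] at hz ⊢
        grind
      have := Finset.card_le_card this
      omega
  obtain ⟨y, hy, z, hz, hyz⟩ := Finset.one_lt_card.1 (show 1 < B.card by omega)
  simp only [hB, Finset.mem_filter, SimpleGraph.mem_neighborFinset] at hy hz
  exact ⟨y, hy.2, z, hz.2, hyz,
    aux_switch k T G hG hmax u v x y huv hu hv he hxu hy.2.1 hx hy.2.2 hy.1,
    aux_switch k T G hG hmax u v x z huv hu hv he hxu hz.2.1 hx hz.2.2 hz.1⟩

open Classical in
theorem aux_exists_nonadj {V : Type*} [Fintype V] (G : SimpleGraph V) (u : V)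
    (h : G.degree u + 1 < Fintype.card V) : ∃ x, x ≠ u ∧ ¬ G.Adj u x := by
  by_contra hcon
  push Not at hcon
  have : (Finset.univ : Finset V) ⊆ insert u (G.neighborFinset u) := by
    intro x _
    simp only [SimpleGraph.mem_neighborFinset, Finset.mem_insert]
    have := hcon x
    tauto
  have := (Finset.card_le_card this).trans (Finset.card_insert_le _ _)
  rw [Finset.card_univ, SimpleGraph.card_neighborFinset_eq_degree] at this
  omega

open Classical in
theorem aux_main {V : Type*} [Fintype V] (k : ℕ) (T G : SimpleGraph V) (hT : T.IsAcyclic)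
    (hn : k + 1 ≤ Fintype.card V) (hG : AuxGood k T G)
    (hmax : ∀ G', AuxGood k T G' → G'.edgeFinset.card ≤ G.edgeFinset.card)
    (u v : V) (hu : G.degree u < k) (hv : G.degree v < k)
    (he : u = v → G.degree u + 2 ≤ k) : False := by
  have huv : u = v ∨ G.Adj u v := by
    by_cases h : u = v
    · exact Or.inl h
    · exact Or.inr (aux_add k T G hG hmax u v h hu hv)
  have huv' : v = u ∨ G.Adj v u := by
    rcases huv with h | h
    · exact Or.inl h.symm
    · exact Or.inr h.symm
  refine aux_forest_core T hT
    {x | (x ≠ u ∧ ¬ G.Adj u x) ∨ (x ≠ v ∧ ¬ G.Adj v x)} ?_ ?_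
  · obtain ⟨x, hx⟩ := aux_exists_nonadj G u (by omega)
    exact ⟨x, Or.inl hx⟩
  · rintro x (hx | hx)
    · obtain ⟨y, hy, z, hz, h⟩ := aux_half k T G hG hmax u v huv hu hv he x hx.1 hx.2
      exact ⟨y, Or.inr hy, z, Or.inr hz, h⟩
    · obtain ⟨y, hy, z, hz, h⟩ := aux_half k T G hG hmax v u huv' hv hu
        (fun h => by subst h; exact he rfl) x hx.1 hx.2
      exact ⟨y, Or.inl hy, z, Or.inl hz, h⟩

open Classical in
theorem aux_upper {V : Type*} [Fintype V] (k : ℕ) (T : SimpleGraph V) (hT : T.IsAcyclic)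
    (hn : k + 1 ≤ Fintype.card V) :
    ∃ G : SimpleGraph V, T ≤ G ∧ (∀ v, k ≤ G.degree v) ∧
      G.edgeFinset.card = T.edgeFinset.card + ((∑ v : V, (k - T.degree v)) + 1) / 2 := by
  obtain ⟨G, hG, hmax⟩ := Finset.exists_max_image
    (Finset.univ.filter (fun G : SimpleGraph V => AuxGood k T G)) (fun G => G.edgeFinset.card)
    ⟨T, by simp [AuxGood]⟩
  simp only [Finset.mem_filter, Finset.mem_univ, true_and] at hG hmax
  have key := aux_main k T G hT hn hG hmax
  have sG := G.sum_degrees_eq_twice_card_edges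
  have sT := T.sum_degrees_eq_twice_card_edges
  have hle : ∀ v, T.degree v ≤ G.degree v := fun v => SimpleGraph.degree_le_of_le hG.1
  have hid : ∑ v, G.degree v + ∑ v, (k - G.degree v) = ∑ v, T.degree v + ∑ v, (k - T.degree v) := by
    rw [← Finset.sum_add_distrib, ← Finset.sum_add_distrib]
    refine Finset.sum_congr rfl fun v _ => ?_
    have := hG.2 v
    have := hle v
    omega
  by_cases hall : ∀ v, k ≤ G.degree v
  · refine ⟨G, hG.1, hall, ?_⟩
    have : ∑ v, (k - G.degree v) = 0 := Finset.sum_eq_zero fun v _ => by have := hall v; omega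
    omega
  · push Not at hall
    obtain ⟨u, hu⟩ := hall
    have h1 : G.degree u + 1 = k := by
      by_contra h
      exact key u u hu hu (fun _ => by omega)
    have h2 : ∀ v, v ≠ u → k ≤ G.degree v := by
      intro v hv
      by_contra h
      exact key u v hu (by omega) (fun h => absurd h.symm hv)
    have : ∑ v, (k - G.degree v) = 1 := by
      rw [Finset.sum_eq_single u]
      · omega
      · intro v _ hv
        have := h2 v hv
        omega
      · simp
    obtain ⟨x, hx, hux⟩ := aux_exists_nonadj G u (by omega)
    obtain ⟨G', ha, hc⟩ := aux_edge G u x hx.symm hux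
    have hle' : G ≤ G' := fun a b hab => (ha a b).2 (Or.inl hab)
    refine ⟨G', hG.1.trans hle', ?_, ?_⟩
    · intro v
      by_cases hv : v = u
      · subst hv
        have : insert x (G.neighborFinset v) ⊆ G'.neighborFinset v := by
          intro z hz
          simp only [SimpleGraph.mem_neighborFinset, ha,
            Finset.mem_insert] at hz ⊢
          grind
        have := Finset.card_le_card this
        rw [Finset.card_insert_of_notMem (by simpa using hux),
          SimpleGraph.card_neighborFinset_eq_degree,
          SimpleGraph.card_neighborFinset_eq_degree] at this
        omega
      · exact (h2 v hv).trans (SimpleGraph.degree_le_of_le hle')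
    · omega

/-- For every integer `k ≥ 1` and every forest `T` on at least `k+1` vertices, the minimum
number of edges that must be added to `T` (on the same vertex set) so that the resulting
graph has minimum degree at least `k` equals `⌈df(T)/2⌉`, where
`df(T) = ∑ v, max(0, k - deg_T v)`. -/
theorem forest_completion_min_additions {V : Type*} [Fintype V]
    (k : ℕ) (hk : 1 ≤ k) (T : SimpleGraph V) (hT : T.IsAcyclic)
    (hn : k + 1 ≤ Fintype.card V) :
    IsLeast {m : ℕ | ∃ G' : SimpleGraph V, T ≤ G' ∧
        (∀ v : V, k ≤ (G'.neighborSet v).ncard) ∧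
        m = G'.edgeSet.ncard - T.edgeSet.ncard}
      (((∑ v : V, (k - (T.neighborSet v).ncard)) + 1) / 2) := by
  classical
  have hd : ∀ (G : SimpleGraph V) (v : V), (G.neighborSet v).ncard = G.degree v := by
    intro G v
    rw [Set.ncard_eq_toFinset_card', ← SimpleGraph.card_neighborFinset_eq_degree]
    rfl
  have hE : ∀ (G : SimpleGraph V), G.edgeSet.ncard = G.edgeFinset.card := by
    intro G
    rw [Set.ncard_eq_toFinset_card']
    rfl
  simp only [hd, hE]
  constructor
  · obtain ⟨G, h1, h2, h3⟩ := aux_upper k T hT hn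
    refine ⟨G, h1, fun v => ?_, ?_⟩
    · convert h2 v
    · have h3' : G.edgeFinset.card =
        T.edgeFinset.card + ((∑ v : V, (k - T.degree v)) + 1) / 2 := by convert h3
      omega
  · rintro m ⟨G, h1, h2, rfl⟩
    have sG := G.sum_degrees_eq_twice_card_edges
    have sT := T.sum_degrees_eq_twice_card_edges
    have hid : ∑ v, T.degree v + ∑ v, (k - T.degree v) ≤ ∑ v, G.degree v := by
      rw [← Finset.sum_add_distrib]
      refine Finset.sum_le_sum fun v _ => ?_
      have := h2 v
      have : T.degree v ≤ G.degree v := SimpleGraph.degree_le_of_le h1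
      omega
    omega
end

section
/- For every integer k ≥ 1 and every forest T on at least k+1 vertices, there exists a set F of exactly ⌈ df(T)/2 ⌉ edges on V(T), disjoint from E(T), such that the graph T + F has minimum degree at least k. -/
namespace ForestCompletion

open Finset

open Classical in
/-- number of neighbours of `x` in `S` -/
noncomputable def cnt {V : Type*} (G : SimpleGraph V) (S : Finset V) (x : V) : ℕ :=
  (S.filter (fun y => G.Adj x y)).card

section
variable {V : Type*}

open Classical in
lemma cnt_eq_sum (G : SimpleGraph V) (S : Finset V) (x : V) :
    cnt G S x = ∑ y ∈ S, if G.Adj x y then 1 else 0 := by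
  simp [cnt]

open Classical in
lemma cnt_insert (G : SimpleGraph V) {S : Finset V} {v : V} (hv : v ∉ S) (x : V) :
    cnt G (insert v S) x = cnt G S x + if G.Adj x v then 1 else 0 := by
  rw [cnt_eq_sum, cnt_eq_sum, Finset.sum_insert hv, add_comm]

open Classical in
lemma cnt_double (G : SimpleGraph V) (A B : Finset V) :
    ∑ x ∈ A, cnt G B x = ∑ x ∈ B, cnt G A x := by
  simp only [cnt_eq_sum]
  rw [Finset.sum_comm]
  simp only [G.adj_comm]

lemma exists_leaf (T : SimpleGraph V) (hT : T.IsAcyclic) (S : Finset V) (hS : S.Nonempty) :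
    ∃ v ∈ S, cnt T S v ≤ 1 := by
  classical
  obtain ⟨s, hs⟩ := hS
  have : Nonempty (S : Set V) := ⟨⟨s, hs⟩⟩
  have hG := hT.induce (S : Set V)
  obtain ⟨u, v, p, hp, hmax⟩ :=
    SimpleGraph.Walk.exists_isPath_forall_isPath_length_le_length (T.induce (S : Set V))
  refine ⟨u, u.2, ?_⟩
  have key : ∀ w, (T.induce (S : Set V)).Adj u w → w = p.snd := by
    intro w hw
    apply hG.eq_snd_of_adj_start hp hw
    by_contra hns
    have := hmax _ _ _ (hp.cons (h := hw.symm) hns)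
    simp at this
  unfold cnt
  rw [Finset.card_le_one]
  intro a ha b hb
  simp only [Finset.mem_filter] at ha hb
  have h1 := key ⟨a, ha.1⟩ ha.2
  have h2 := key ⟨b, hb.1⟩ hb.2
  have := h1.trans h2.symm
  exact congrArg Subtype.val this

lemma sum_self (T : SimpleGraph V) (hT : T.IsAcyclic) : ∀ (n : ℕ) (S : Finset V), S.card = n + 1 →
    ∑ x ∈ S, cnt T S x + 2 ≤ 2 * S.card := by
  classical
  intro n
  induction n with
  | zero =>
    intro S hS
    obtain ⟨a, rfl⟩ := Finset.card_eq_one.mp hS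
    simp [cnt, Finset.filter_singleton]
  | succ n ih =>
    intro S hS
    obtain ⟨v, hv, hle⟩ := exists_leaf T hT S (Finset.card_pos.mp (by omega))
    have hc : (S.erase v).card = n + 1 := by rw [Finset.card_erase_of_mem hv]; omega
    have := ih _ hc
    have hn : v ∉ S.erase v := by simp
    have hins : insert v (S.erase v) = S := Finset.insert_erase hv
    generalize S.erase v = S' at *
    subst hins
    rw [Finset.sum_insert hn]
    simp only [cnt_insert T hn, Finset.sum_add_distrib] at hle ⊢
    have h3 : ∑ x ∈ S', (if T.Adj x v then 1 else 0) = cnt T S' v := by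
      rw [cnt_eq_sum]; simp only [T.adj_comm]
    simp at hle ⊢
    simp at h3
    omega

lemma sum_sub (T : SimpleGraph V) (hT : T.IsAcyclic) (S U : Finset V) (hU : U ⊆ S)
    (hne : U.Nonempty) : ∑ x ∈ U, cnt T S x + 2 ≤ S.card + U.card := by
  classical
  have h1 := sum_self T hT (U.card - 1) U (by have := hne.card_pos; omega)
  have hS : 0 < S.card := (hne.mono hU).card_pos
  have h2 := sum_self T hT (S.card - 1) S (by omega)
  have h3 : ∀ x, cnt T S x = cnt T U x + cnt T (S \ U) x := by
    intro x
    simp only [cnt_eq_sum]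
    rw [add_comm, Finset.sum_sdiff hU]
  have h4 := Finset.sum_sdiff (f := fun x => cnt T S x) hU
  simp only [h3, Finset.sum_add_distrib] at h2 h4 ⊢
  have h5 := cnt_double T U (S \ U)
  omega

end
section
variable {V : Type*}

/-- A matching of `G` encoded as an involution. -/
structure IsMt (G : SimpleGraph V) (f : V → V) : Prop where
  inv : ∀ x, f (f x) = x
  adj : ∀ x, f x ≠ x → G.Adj x (f x)

variable [Fintype V]

open Classical in
/-- covered vertices -/
noncomputable def supp (f : V → V) : Finset V := univ.filter (fun x => f x ≠ x)

lemma mem_supp (f : V → V) (x : V) : x ∈ supp f ↔ f x ≠ x := by simp [supp]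

open Classical in
lemma mt_add {G : SimpleGraph V} {f : V → V} (hf : IsMt G f) {x y : V} (hx : f x = x)
    (hy : f y = y) (hxy : G.Adj x y) :
    ∃ g, IsMt G g ∧ supp g = insert x (insert y (supp f)) := by
  have hne : x ≠ y := hxy.ne
  have hyx := hxy.symm
  have hi := hf.inv
  have ha := hf.adj
  refine ⟨fun z => if z = x then y else if z = y then x else f z, ⟨?_, ?_⟩, ?_⟩
  · intro z
    grind
  · intro z
    grind
  · ext z
    simp only [mem_supp, Finset.mem_insert]
    grind

open Classical in
lemma mt_drop {G : SimpleGraph V} {f : V → V} (hf : IsMt G f) (p : V) :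
    ∃ g, IsMt G g ∧ supp g = ((supp f).erase p).erase (f p) ∧ ∀ z, z ≠ p → z ≠ f p → g z = f z := by
  have hi := hf.inv
  have ha := hf.adj
  refine ⟨fun z => if z = p ∨ z = f p then z else f z, ⟨?_, ?_⟩, ?_, ?_⟩
  · intro z
    grind
  · intro z
    grind
  · ext z
    simp only [mem_supp, Finset.mem_erase]
    grind
  · intro z
    grind

lemma mt_card_drop {G : SimpleGraph V} {f : V → V} (hf : IsMt G f) {p : V} (hp : f p ≠ p) :
    ∃ g, IsMt G g ∧ (supp g).card + 2 = (supp f).card ∧ g p = p ∧ g (f p) = f p ∧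
      ∀ z, z ≠ p → z ≠ f p → g z = f z := by
  classical
  obtain ⟨g, hg, hs, he⟩ := mt_drop hf p
  have h1 : p ∈ supp f := by rwa [mem_supp]
  have h2 : f p ∈ (supp f).erase p := by
    rw [Finset.mem_erase, mem_supp, hf.inv]; exact ⟨hp, hp.symm⟩
  have h3 := Finset.card_erase_add_one h1
  have h4 := Finset.card_erase_add_one h2
  refine ⟨g, hg, by rw [hs]; omega, ?_, ?_, he⟩
  · have : p ∉ supp g := by rw [hs]; simp
    simpa [mem_supp] using this
  · have : f p ∉ supp g := by rw [hs]; simp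
    simpa [mem_supp] using this

lemma mt_card_add {G : SimpleGraph V} {f : V → V} (hf : IsMt G f) {x y : V} (hx : f x = x)
    (hy : f y = y) (hxy : G.Adj x y) :
    ∃ g, IsMt G g ∧ (supp g).card = (supp f).card + 2 ∧ g x ≠ x := by
  classical
  obtain ⟨g, hg, hs⟩ := mt_add hf hx hy hxy
  refine ⟨g, hg, ?_, ?_⟩
  · rw [hs, Finset.card_insert_of_notMem, Finset.card_insert_of_notMem]
    · simp [mem_supp, hy]
    · simp [mem_supp, hx, hxy.ne]
  · have : x ∈ supp g := by rw [hs]; simp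
    simpa [mem_supp] using this

lemma mt_augment {G : SimpleGraph V} {f : V → V} (hf : IsMt G f) {x y : V} (hx : f x = x)
    (hy : f y = y) (hxy : x ≠ y)
    (hno : ¬ ∃ g, IsMt G g ∧ (supp g).card = (supp f).card + 2) :
    cnt G univ x + cnt G univ y ≤ (supp f).card := by
  classical
  have h1 : ∀ a p, f a = a → G.Adj a p → f p ≠ p := by
    intro a p ha hap hp
    obtain ⟨g, hg, hc, -⟩ := mt_card_add hf ha hp hap
    exact hno ⟨g, hg, hc⟩
  have h2 : ∀ p, G.Adj x p → ¬ G.Adj y (f p) := by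
    intro p hp hq
    have hfp := h1 x p hx hp
    obtain ⟨g, hg, hc, hgp, hgq, hz⟩ := mt_card_drop hf hfp
    have hxf : x ≠ f p := by
      intro h
      have h' := hf.inv p
      rw [← h, hx] at h'
      exact hp.ne h'
    have hyp : y ≠ p := by
      intro h
      rw [← h] at hfp
      exact hfp hy
    have hgx : g x = x := by rw [hz x hp.ne hxf, hx]
    have hgy : g y = y := by rw [hz y hyp hq.ne, hy]
    obtain ⟨g1, hg1, hs1⟩ := mt_add hg hgx hgp hp
    have hgy1 : g1 y = y := by
      have : y ∉ supp g1 := by rw [hs1]; simp [mem_supp, hgy, hxy.symm, hyp]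
      simpa [mem_supp] using this
    have hgq1 : g1 (f p) = f p := by
      have : f p ∉ supp g1 := by rw [hs1]; simp [mem_supp, hgq, hxf.symm, hfp]
      simpa [mem_supp] using this
    obtain ⟨g2, hg2, hc2, -⟩ := mt_card_add hg1 hgy1 hgq1 hq
    refine hno ⟨g2, hg2, ?_⟩
    rw [hc2, hs1, Finset.card_insert_of_notMem, Finset.card_insert_of_notMem]
    · omega
    · simp [mem_supp, hgp]
    · simp [mem_supp, hgx, hp.ne]
  have hinj : Function.Injective f := fun a b h => by
    have := congrArg f h
    rwa [hf.inv, hf.inv] at this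
  unfold cnt
  rw [← Finset.card_image_of_injective (univ.filter (fun p => G.Adj x p)) hinj,
    ← Finset.card_union_of_disjoint]
  · apply Finset.card_le_card
    intro z hz
    rw [mem_supp]
    simp only [Finset.mem_union, Finset.mem_image, Finset.mem_filter, Finset.mem_univ,
      true_and] at hz
    rcases hz with ⟨p, hp, rfl⟩ | hz
    · rw [hf.inv]; exact (h1 x p hx hp).symm
    · exact h1 y z hy hz
  · rw [Finset.disjoint_left]
    intro z hz hz'
    simp only [Finset.mem_image, Finset.mem_filter, Finset.mem_univ, true_and] at hz hz'
    obtain ⟨p, hp, rfl⟩ := hz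
    exact h2 p hp hz'

lemma mt_cover {G : SimpleGraph V} {f : V → V} (hf : IsMt G f) (hc : 0 < (supp f).card) {u w : V}
    (huw : G.Adj u w) : ∃ g, IsMt G g ∧ (supp g).card = (supp f).card ∧ g u ≠ u := by
  classical
  by_cases hu : f u = u
  · have main : ∃ p, f p ≠ p ∧ (f w ≠ w → p = w) := by
      by_cases hw : f w = w
      · obtain ⟨p, hp⟩ := Finset.card_pos.mp hc
        exact ⟨p, by simpa [mem_supp] using hp, fun h => absurd hw h⟩
      · exact ⟨w, hw, fun _ => rfl⟩
    obtain ⟨p, hp, hpw⟩ := main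
    obtain ⟨g, hg, hcg, hgp, hgq, hz⟩ := mt_card_drop hf hp
    have h1 : ∀ z, f z = z → g z = z := by
      intro z hfz
      by_cases e1 : z = p
      · rw [e1, hgp]
      by_cases e2 : z = f p
      · rw [e2, hgq]
      rw [hz z e1 e2, hfz]
    have hgw : g w = w := by
      by_cases hw : f w = w
      · exact h1 w hw
      · rw [← hpw hw, hgp]
    obtain ⟨g2, hg2, hc2, h3⟩ := mt_card_add hg (h1 u hu) hgw huw
    exact ⟨g2, hg2, by omega, h3⟩
  · exact ⟨f, hf, rfl, hu⟩

end
section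
variable {V : Type*} [Fintype V]

lemma exists_mt_abs (T : SimpleGraph V) (hT : T.IsAcyclic) (k : ℕ) (hk : 3 ≤ k) (S Q : Finset V)
    (hS : k + 1 ≤ S.card) (hQ : Q ⊆ S) (G : SimpleGraph V) (c K : ℕ) (hc : c + K ≤ k + 1)
    (hQc : S.card + 1 ≤ Q.card + c)
    (hp : ∀ x ∈ Q, ∀ y ∈ Q, x ≠ y →
      2 * k ≤ cnt G univ x + cnt G univ y + cnt T S x + cnt T S y + c) :
    ∀ j, 2 * j ≤ K → ∃ f, IsMt G f ∧ (supp f).card = 2 * j := by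
  classical
  intro j
  induction j with
  | zero =>
    intro _
    exact ⟨id, ⟨fun x => rfl, fun x hx => absurd rfl hx⟩, by simp [supp]⟩
  | succ j ih =>
    intro hj
    obtain ⟨f, hf, hcf⟩ := ih (by omega)
    by_contra hno
    have hno' : ¬ ∃ g, IsMt G g ∧ (supp g).card = (supp f).card + 2 := by
      rintro ⟨g, hg, h⟩
      exact hno ⟨g, hg, by omega⟩
    set U := Q \ supp f with hU
    have hUc : Q.card ≤ U.card + (supp f).card := by
      have : Q.card - (supp f).card ≤ U.card := Finset.le_card_sdiff (supp f) Q
      omega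
    have hUQ : U ⊆ Q := Finset.sdiff_subset
    have pair : ∀ x ∈ U, ∀ y ∈ U, x ≠ y → k + 1 ≤ cnt T S x + cnt T S y := by
      intro x hx y hy hxy
      have h1 := hp x (hUQ hx) y (hUQ hy) hxy
      rw [hU, Finset.mem_sdiff, mem_supp, not_not] at hx hy
      have h2 := mt_augment hf hx.2 hy.2 hxy hno'
      omega
    have hU3 : S.card + 2 ≤ U.card + k := by omega
    obtain ⟨x0, hx0, hmin⟩ := Finset.exists_min_image U (fun x => cnt T S x)
      (Finset.card_pos.mp (by omega))
    have hc1 := Finset.card_erase_add_one hx0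
    obtain ⟨y1, hy1⟩ := Finset.card_pos.mp (show 0 < (U.erase x0).card by omega)
    have hc2 := Finset.card_erase_add_one hy1
    have hs1 := Finset.add_sum_erase U (fun x => cnt T S x) hx0
    have hs2 := Finset.add_sum_erase (U.erase x0) (fun x => cnt T S x) hy1
    have hrest : ((U.erase x0).erase y1).card * (k + 1) ≤
        ∑ x ∈ (U.erase x0).erase y1, 2 * cnt T S x := by
      rw [← smul_eq_mul]
      apply Finset.card_nsmul_le_sum
      intro x hx
      simp only [Finset.mem_erase] at hx
      have h1 := pair x hx.2.2 x0 hx0 hx.2.1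
      have h2 := hmin x hx.2.2
      omega
    rw [← Finset.mul_sum] at hrest
    have hy1' := Finset.mem_erase.mp hy1
    have h01 := pair x0 hx0 y1 hy1'.2 (Ne.symm hy1'.1)
    have hsub := sum_sub T hT S U (hUQ.trans hQ) ⟨x0, hx0⟩
    set q := ((U.erase x0).erase y1).card
    have hq : U.card = q + 2 := by omega
    have : (q + 2) * (k + 1) ≤ 2 * ∑ x ∈ U, cnt T S x := by
      rw [← hs1, ← hs2]
      nlinarith
    obtain ⟨k', rfl⟩ := Nat.exists_eq_add_of_le hk
    nlinarith

/-- near-exact completion of `T[S]` -/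
structure Good (T : SimpleGraph V) (k : ℕ) (S : Finset V) (F : SimpleGraph V) (a : V) (e : ℕ) :
    Prop where
  sub : ∀ x y, F.Adj x y → x ∈ S ∧ ¬ T.Adj x y
  ha : a ∈ S
  he : e ≤ 1
  deg : ∀ x ∈ S, x ≠ a → cnt F univ x = k - cnt T S x
  dega : cnt F univ a + e = k - cnt T S a

/-- delete the edges at `a` -/
def del (F : SimpleGraph V) (a : V) : SimpleGraph V where
  Adj x y := F.Adj x y ∧ x ≠ a ∧ y ≠ a
  symm := ⟨fun _ _ h => ⟨h.1.symm, h.2.2, h.2.1⟩⟩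
  loopless := ⟨fun _ h => h.1.ne rfl⟩


lemma cnt_pos_iff (F : SimpleGraph V) (S : Finset V) (x : V) :
    0 < cnt F S x ↔ ∃ y ∈ S, F.Adj x y := by
  classical
  unfold cnt
  rw [Finset.card_pos]
  simp [Finset.Nonempty]

lemma cnt_del (F : SimpleGraph V) (a x : V) (hx : x ≠ a) :
    cnt F univ x ≤ cnt (del F a) univ x + 1 := by
  classical
  unfold cnt
  have : univ.filter (fun y => F.Adj x y) ⊆ insert a (univ.filter (fun y => (del F a).Adj x y)) := by
    intro y hy
    simp only [Finset.mem_filter, Finset.mem_univ, true_and, Finset.mem_insert] at hy ⊢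
    by_cases h : y = a
    · exact Or.inl h
    · exact Or.inr (show F.Adj x y ∧ x ≠ a ∧ y ≠ a from ⟨hy, hx, h⟩)
  exact (Finset.card_le_card this).trans (Finset.card_insert_le _ _)

lemma mt_even {T : SimpleGraph V} (hT : T.IsAcyclic) {k : ℕ} {S : Finset V}
    (hS : k + 1 ≤ S.card) {F : SimpleGraph V} {a : V} {e : ℕ} (hF : Good T k S F a e) {t : ℕ}
    (ht : k = 2 * t) (hk : 1 ≤ k) : ∃ f, IsMt F f ∧ (supp f).card = k := by
  classical
  by_cases h3 : 3 ≤ k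
  · have := exists_mt_abs T hT k h3 S S hS (Finset.Subset.refl _) F 1 k (by omega) (by omega) ?_ t
      (by omega)
    · rwa [← ht] at this
    · intro x hx y hy hxy
      have he := hF.he
      have hda := hF.dega
      by_cases h1 : x = a
      · have := hF.deg y hy (by rw [← h1]; exact hxy.symm)
        subst h1
        omega
      · have h4 := hF.deg x hx h1
        by_cases h2 : y = a
        · subst h2
          omega
        · have := hF.deg y hy h2
          omega
  · have hk2 : k = 2 := by omega
    have : ∃ x y, F.Adj x y := by
      by_contra hno
      push Not at hno
      have h0 : ∀ x, cnt F univ x = 0 := by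
        intro x
        by_contra h
        obtain ⟨y, -, hy⟩ := (cnt_pos_iff F univ x).mp (Nat.pos_of_ne_zero h)
        exact hno x y hy
      have h1 := sum_sub T hT S S (Finset.Subset.refl _) ⟨a, hF.ha⟩
      have h2 := Finset.add_sum_erase S (fun x => cnt T S x) hF.ha
      have h3 := Finset.card_erase_add_one hF.ha
      have h4 : (S.erase a).card * 2 ≤ ∑ x ∈ S.erase a, cnt T S x := by
        rw [← smul_eq_mul]
        apply Finset.card_nsmul_le_sum
        intro x hx
        simp only [Finset.mem_erase] at hx
        have := hF.deg x hx.2 hx.1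
        rw [h0] at this
        omega
      have h5 := hF.dega
      have h6 := hF.he
      rw [h0] at h5
      omega
    obtain ⟨x, y, hxy⟩ := this
    have hid : IsMt F (id : V → V) := ⟨fun x => rfl, fun x hx => absurd rfl hx⟩
    obtain ⟨g, hg, hc, -⟩ := mt_card_add hid rfl rfl hxy
    refine ⟨g, hg, ?_⟩
    rw [hc, hk2]
    simp [supp]

lemma mt_odd {T : SimpleGraph V} (hT : T.IsAcyclic) {k : ℕ} {S : Finset V}
    (hS : k + 1 ≤ S.card) {F : SimpleGraph V} {a : V} {e : ℕ} (hF : Good T k S F a e) {t : ℕ}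
    (ht : k = 2 * t + 1) : ∃ f, IsMt (del F a) f ∧ (supp f).card = 2 * t := by
  classical
  by_cases h3 : 3 ≤ k
  · have hca := Finset.card_erase_add_one hF.ha
    refine exists_mt_abs T hT k h3 S (S.erase a) hS (Finset.erase_subset _ _) (del F a) 2 (k - 1)
      (by omega) (by omega) ?_ t (by omega)
    intro x hx y hy hxy
    simp only [Finset.mem_erase] at hx hy
    have h1 := hF.deg x hx.2 hx.1
    have h2 := hF.deg y hy.2 hy.1
    have h4 := cnt_del F a x hx.1
    have h5 := cnt_del F a y hy.1
    omega
  · exact ⟨id, ⟨fun x => rfl, fun x hx => absurd rfl hx⟩, by simp [supp]; omega⟩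


lemma IsMt.of_del {F : SimpleGraph V} {a : V} {f : V → V} (h : IsMt (del F a) f) :
    IsMt F f ∧ f a = a := by
  refine ⟨⟨h.inv, fun x hx => (h.adj x hx).1⟩, ?_⟩
  by_contra hne
  exact (h.adj a hne).2.1 rfl

lemma mt_avoid {T : SimpleGraph V} (hT : T.IsAcyclic) {k : ℕ} {S : Finset V}
    (hS : k + 1 ≤ S.card) {F : SimpleGraph V} {a : V} {e : ℕ} (hF : Good T k S F a e)
    (hk : 1 ≤ k) : ∃ f, IsMt F f ∧ f a = a ∧ (supp f).card = 2 * ((k - 1) / 2) := by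
  rcases Nat.even_or_odd' k with ⟨t, ht | ht⟩
  · obtain ⟨f, hf, hc⟩ := mt_even hT hS hF ht hk
    by_cases h : f a = a
    · obtain ⟨p, hp⟩ := Finset.card_pos.mp (show 0 < (supp f).card by omega)
      rw [mem_supp] at hp
      obtain ⟨g, hg, hcg, h1, h2, h3⟩ := mt_card_drop hf hp
      refine ⟨g, hg, ?_, by omega⟩
      by_cases e1 : a = p
      · rw [e1, h1]
      by_cases e2 : a = f p
      · rw [e2, h2]
      rw [h3 a e1 e2, h]
    · obtain ⟨g, hg, hcg, h1, h2, h3⟩ := mt_card_drop hf h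
      exact ⟨g, hg, h1, by omega⟩
  · obtain ⟨f, hf, hc⟩ := mt_odd hT hS hF ht
    obtain ⟨h1, h2⟩ := hf.of_del
    exact ⟨f, h1, h2, by omega⟩

end
section
variable {V : Type*} [Fintype V]

/-- add the edge `p q` -/
def addE (F : SimpleGraph V) (p q : V) (h : p ≠ q) : SimpleGraph V where
  Adj x y := F.Adj x y ∨ (x = p ∧ y = q) ∨ (x = q ∧ y = p)
  symm := ⟨fun _ _ h => by
    rcases h with h | h | h
    · exact Or.inl h.symm
    · exact Or.inr (Or.inr ⟨h.2, h.1⟩)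
    · exact Or.inr (Or.inl ⟨h.2, h.1⟩)⟩
  loopless := ⟨fun x hx => by
    rcases hx with hx | hx | hx
    · exact hx.ne rfl
    · exact h (hx.1.symm.trans hx.2)
    · exact h (hx.2.symm.trans hx.1)⟩

/-- delete the edge `p q` -/
def delE (F : SimpleGraph V) (p q : V) : SimpleGraph V where
  Adj x y := F.Adj x y ∧ ¬ (x = p ∧ y = q) ∧ ¬ (x = q ∧ y = p)
  symm := ⟨fun _ _ h => ⟨h.1.symm, fun h' => h.2.2 ⟨h'.2, h'.1⟩, fun h' => h.2.1 ⟨h'.2, h'.1⟩⟩⟩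
  loopless := ⟨fun _ h => h.1.ne rfl⟩

lemma addE_adj (F : SimpleGraph V) (p q : V) (h : p ≠ q) (x y : V) :
    (addE F p q h).Adj x y ↔ F.Adj x y ∨ (x = p ∧ y = q) ∨ (x = q ∧ y = p) := Iff.rfl

lemma delE_adj (F : SimpleGraph V) (p q : V) (x y : V) :
    (delE F p q).Adj x y ↔ F.Adj x y ∧ ¬ (x = p ∧ y = q) ∧ ¬ (x = q ∧ y = p) := Iff.rfl

open Classical in
lemma cnt_addE (F : SimpleGraph V) (p q : V) (h : p ≠ q) (hn : ¬ F.Adj p q) (z : V) :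
    cnt (addE F p q h) univ z =
      cnt F univ z + (if z = p then 1 else 0) + (if z = q then 1 else 0) := by
  have hn' : ¬ F.Adj q p := fun h => hn h.symm
  unfold cnt
  by_cases h1 : z = p
  · subst h1
    rw [if_pos rfl, if_neg h, add_zero, ← Finset.card_insert_of_notMem (a := q)]
    · congr 1
      ext y
      simp only [Finset.mem_filter, Finset.mem_univ, true_and, Finset.mem_insert, addE_adj]
      grind
    · simp [hn]
  · by_cases h2 : z = q
    · subst h2
      rw [if_pos rfl, if_neg h1, add_zero, ← Finset.card_insert_of_notMem (a := p)]
      · congr 1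
        ext y
        simp only [Finset.mem_filter, Finset.mem_univ, true_and, Finset.mem_insert, addE_adj]
        grind
      · simp [hn']
    · rw [if_neg h1, if_neg h2]
      simp only [addE_adj, h1, h2, false_and, or_false, add_zero]

open Classical in
lemma cnt_delE (F : SimpleGraph V) (p q : V) (hn : F.Adj p q) (z : V) :
    cnt (delE F p q) univ z + (if z = p then 1 else 0) + (if z = q then 1 else 0) =
      cnt F univ z := by
  have h := hn.ne
  have h0 : ¬ (delE F p q).Adj p q := by simp [delE_adj]
  rw [← cnt_addE (delE F p q) p q h h0]
  congr 1
  ext x y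
  have := hn.symm
  simp only [addE_adj, delE_adj]
  grind

lemma exists_far {T : SimpleGraph V} (hT : T.IsAcyclic) {k : ℕ} (hk : 3 ≤ k) {S : Finset V}
    (hS : k + 1 ≤ S.card) {F : SimpleGraph V} {a : V} (hF : Good T k S F a 1) {u : V}
    (hu : u ∈ S) (hua : F.Adj u a) (hut : k ≤ cnt T S u + 1) :
    ∃ p ∈ S, p ≠ a ∧ ¬ F.Adj a p ∧ ¬ T.Adj a p ∧ cnt T S p < k := by
  classical
  by_contra hno
  push Not at hno
  set Z := S.filter (fun p => p ≠ a ∧ ¬ F.Adj a p ∧ ¬ T.Adj a p) with hZ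
  have h1 : S ⊆ insert a (Z ∪ (univ.filter (fun p => F.Adj a p) ∪ S.filter (fun p => T.Adj a p))) := by
    intro p hp
    simp only [hZ, Finset.mem_insert, Finset.mem_union, Finset.mem_filter, Finset.mem_univ,
      true_and]
    tauto
  have h2 := Finset.card_le_card h1
  have h3 := Finset.card_insert_le a
    (Z ∪ (univ.filter (fun p => F.Adj a p) ∪ S.filter (fun p => T.Adj a p)))
  have h4 := Finset.card_union_le Z (univ.filter (fun p => F.Adj a p) ∪ S.filter (fun p => T.Adj a p))
  have h5 := Finset.card_union_le (univ.filter (fun p => F.Adj a p)) (S.filter (fun p => T.Adj a p))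
  have h6 := hF.dega
  unfold cnt at h6
  have huZ : u ∉ Z := by
    simp only [hZ, Finset.mem_filter]
    intro h
    exact h.2.2.1 hua.symm
  have hZS : insert u Z ⊆ S := Finset.insert_subset hu (Finset.filter_subset _ _)
  have h7 := sum_sub T hT S (insert u Z) hZS ⟨u, Finset.mem_insert_self _ _⟩
  rw [Finset.sum_insert huZ, Finset.card_insert_of_notMem huZ] at h7
  have h8 : Z.card * k ≤ ∑ x ∈ Z, cnt T S x := by
    rw [← smul_eq_mul]
    apply Finset.card_nsmul_le_sum
    intro x hx
    simp only [hZ, Finset.mem_filter] at hx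
    exact hno x hx.1 hx.2.1 hx.2.2.1 hx.2.2.2
  have h9 : Z.card * 3 ≤ Z.card * k := Nat.mul_le_mul_left _ hk
  omega

lemma shift {T : SimpleGraph V} (hT : T.IsAcyclic) {k : ℕ} (hk : 3 ≤ k) {S : Finset V}
    (hS : k + 1 ≤ S.card) {F : SimpleGraph V} {a : V} {e : ℕ} (hF : Good T k S F a e) {u : V}
    (hu : u ∈ S) (hut : cnt T S u < k) (hn : ¬ (u = a ∧ e = 1)) :
    ∃ F' a' e' w, Good T k S F' a' e' ∧ a' ≠ u ∧ w ≠ a' ∧ F'.Adj u w := by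
  classical
  have he := hF.he
  rcases (show e = 0 ∨ e = 1 by omega) with rfl | rfl
  · have hall : ∀ x ∈ S, cnt F univ x = k - cnt T S x := by
      intro x hx
      by_cases h : x = a
      · have := hF.dega
        rw [h]; omega
      · exact hF.deg x hx h
    have h1 := hall u hu
    obtain ⟨w, -, hw⟩ := (cnt_pos_iff F univ u).mp (by omega)
    have : ∃ a' ∈ S, a' ∉ ({u, w} : Finset V) := by
      apply Finset.exists_mem_notMem_of_card_lt_card
      have := Finset.card_le_two (a := u) (b := w)
      omega
    obtain ⟨a', ha', hna⟩ := this
    simp only [Finset.mem_insert, Finset.mem_singleton, not_or] at hna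
    exact ⟨F, a', 0, w, ⟨hF.sub, ha', by omega, fun x hx _ => hall x hx, by
      rw [hall a' ha', add_zero]⟩, hna.1, Ne.symm hna.2, hw⟩
  · have hua : u ≠ a := fun h => hn ⟨h, rfl⟩
    by_cases hw : ∃ w, w ≠ a ∧ F.Adj u w
    · obtain ⟨w, hwa, hw⟩ := hw
      exact ⟨F, a, 1, w, hF, hua.symm, hwa, hw⟩
    · push Not at hw
      have h1 := hF.deg u hu hua
      obtain ⟨w, -, huw⟩ := (cnt_pos_iff F univ u).mp (by omega)
      have hwa : w = a := by
        by_contra h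
        exact hw w h huw
      subst hwa
      have h2 : cnt F univ u ≤ 1 := by
        unfold cnt
        rw [Finset.card_le_one]
        intro x hx y hy
        simp only [Finset.mem_filter, Finset.mem_univ, true_and] at hx hy
        have hx' : x = w := by
          by_contra h
          exact hw x h hx
        have hy' : y = w := by
          by_contra h
          exact hw y h hy
        rw [hx', hy']
      obtain ⟨p, hpS, hpa, hpF, hpT, hpk⟩ := exists_far hT hk hS hF hu huw (by omega)
      have h3 := hF.deg p hpS hpa
      obtain ⟨q, -, hpq⟩ := (cnt_pos_iff F univ p).mp (by omega)
      have hqS : q ∈ S := (hF.sub q p hpq.symm).1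
      have hqa : q ≠ w := fun h => hpF (h ▸ hpq.symm)
      have hqu : q ≠ u := by
        intro h
        exact hw p hpa (h ▸ hpq.symm)
      have hpu : p ≠ u := fun h => hpF (h ▸ huw.symm)
      have hnd : ¬ (delE F p q).Adj p w := fun h => hpF h.1.symm
      have hcnt : ∀ z, cnt (addE (delE F p q) p w hpa) univ z + (if z = q then 1 else 0)
          = cnt F univ z + if z = w then 1 else 0 := by
        intro z
        rw [cnt_addE _ _ _ _ hnd]
        have := cnt_delE F p q hpq z
        omega
      refine ⟨addE (delE F p q) p w hpa, q, 1, w, ⟨?_, hqS, le_rfl, ?_, ?_⟩, hqu, hqa.symm, ?_⟩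
      · intro x y hxy
        rw [addE_adj, delE_adj] at hxy
        rcases hxy with h | ⟨rfl, rfl⟩ | ⟨rfl, rfl⟩
        · exact hF.sub x y h.1
        · exact ⟨hpS, fun h => hpT h.symm⟩
        · exact ⟨hF.ha, hpT⟩
      · intro x hx hxq
        have h5 := hcnt x
        rw [if_neg hxq] at h5
        by_cases hxw : x = w
        · subst hxw
          have := hF.dega
          rw [if_pos rfl] at h5
          omega
        · have := hF.deg x hx hxw
          rw [if_neg hxw] at h5
          omega
      · have h5 := hcnt q
        rw [if_pos rfl, if_neg hqa] at h5
        have := hF.deg q hqS hqa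
        omega
      · rw [addE_adj, delE_adj]
        left
        exact ⟨huw, fun h => hpu h.1.symm, fun h => hqu h.1.symm⟩

end
section
variable {V : Type*} [Fintype V]

/-- remove the matching `f` and join `v` to `X` -/
def build (F : SimpleGraph V) (f : V → V) (hf : IsMt F f) (X : Finset V) (v : V) (hv : v ∉ X) :
    SimpleGraph V where
  Adj x y := (F.Adj x y ∧ f x ≠ y) ∨ (x = v ∧ y ∈ X) ∨ (y = v ∧ x ∈ X)
  symm := ⟨fun x y h => by
    rcases h with h | h | h
    · refine Or.inl ⟨h.1.symm, fun h' => h.2 ?_⟩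
      rw [← h', hf.inv]
    · exact Or.inr (Or.inr h)
    · exact Or.inr (Or.inl h)⟩
  loopless := ⟨fun x hx => by
    rcases hx with hx | hx | hx
    · exact hx.1.ne rfl
    · exact hv (hx.1 ▸ hx.2)
    · exact hv (hx.1 ▸ hx.2)⟩

lemma build_adj (F : SimpleGraph V) (f : V → V) (hf : IsMt F f) (X : Finset V) (v : V) (hv : v ∉ X)
    (x y : V) : (build F f hf X v hv).Adj x y ↔
      (F.Adj x y ∧ f x ≠ y) ∨ (x = v ∧ y ∈ X) ∨ (y = v ∧ x ∈ X) := Iff.rfl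

open Classical in
lemma cnt_build (F : SimpleGraph V) (f : V → V) (hf : IsMt F f) (X : Finset V) (v : V) (hv : v ∉ X)
    (hFv : ∀ y, ¬ F.Adj y v) (x : V) (hx : x ≠ v) :
    cnt (build F f hf X v hv) univ x + (if f x ≠ x then 1 else 0) =
      cnt F univ x + if x ∈ X then 1 else 0 := by
  have h1 : univ.filter (fun y => (build F f hf X v hv).Adj x y) =
      (univ.filter (fun y => F.Adj x y)).erase (f x) ∪ if x ∈ X then {v} else ∅ := by
    ext y
    simp only [Finset.mem_filter, Finset.mem_univ, true_and, build_adj, Finset.mem_union,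
      Finset.mem_erase]
    by_cases hX : x ∈ X <;> simp [hX, hx] <;> tauto
  have h2 : Disjoint ((univ.filter (fun y => F.Adj x y)).erase (f x))
      (if x ∈ X then {v} else ∅) := by
    by_cases hX : x ∈ X <;> simp [hX, hFv]
  unfold cnt
  rw [h1, Finset.card_union_of_disjoint h2]
  have h3 : ((univ.filter (fun y => F.Adj x y)).erase (f x)).card + (if f x ≠ x then 1 else 0) =
      (univ.filter (fun y => F.Adj x y)).card := by
    by_cases hfx : f x = x
    · rw [hfx, Finset.erase_eq_of_notMem (by simp)]
      simp
    · rw [if_pos hfx, Finset.card_erase_add_one]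
      simpa using hf.adj x hfx
  have h4 : (if x ∈ X then ({v} : Finset V) else ∅).card = if x ∈ X then 1 else 0 := by
    by_cases hX : x ∈ X <;> simp [hX]
  rw [h4]
  omega

lemma cnt_build_v (F : SimpleGraph V) (f : V → V) (hf : IsMt F f) (X : Finset V) (v : V)
    (hv : v ∉ X) (hFv : ∀ y, ¬ F.Adj y v) :
    cnt (build F f hf X v hv) univ v = X.card := by
  classical
  unfold cnt
  congr 1
  ext y
  have := hFv y
  have h2 : ¬ F.Adj v y := fun h => this h.symm
  simp only [Finset.mem_filter, Finset.mem_univ, true_and, build_adj]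
  tauto

open Classical in
lemma step_good {T : SimpleGraph V} {k : ℕ} {S : Finset V} {F : SimpleGraph V} {a : V} {e : ℕ}
    (hF : Good T k S F a e) {v : V} (hvS : v ∉ S) {f : V → V} (hf : IsMt F f) {X : Finset V}
    (hX : X ⊆ S) (hXT : ∀ x ∈ X, ¬ T.Adj x v) (b : V) (e' : ℕ) (hb : b ∈ insert v S)
    (he' : e' ≤ 1)
    (h1 : ∀ x ∈ S, cnt F univ x + (if x ∈ X then 1 else 0) + (if x = b then e' else 0) =
      (k - (cnt T S x + if T.Adj x v then 1 else 0)) + if f x ≠ x then 1 else 0)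
    (h2 : X.card + (if v = b then e' else 0) = k - cnt T S v) :
    ∃ F2 b2 e2, Good T k (insert v S) F2 b2 e2 := by
  have hvX : v ∉ X := fun h => hvS (hX h)
  have hFv : ∀ y, ¬ F.Adj y v := fun y h => hvS (hF.sub v y h.symm).1
  have key : ∀ x ∈ insert v S, cnt (build F f hf X v hvX) univ x + (if x = b then e' else 0) =
      k - cnt T (insert v S) x := by
    intro x hx
    rw [cnt_insert T hvS]
    rw [Finset.mem_insert] at hx
    by_cases hxv : x = v
    · subst hxv
      rw [cnt_build_v F f hf X x hvX hFv]
      simpa using h2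
    · have hxS := hx.resolve_left hxv
      have h3 := cnt_build F f hf X v hvX hFv x hxv
      have h4 := h1 x hxS
      omega
  refine ⟨build F f hf X v hvX, b, e', ⟨?_, hb, he', ?_, ?_⟩⟩
  · intro x y hxy
    rw [build_adj] at hxy
    rcases hxy with h | h | h
    · exact ⟨Finset.mem_insert_of_mem (hF.sub x y h.1).1, (hF.sub x y h.1).2⟩
    · rw [h.1]
      exact ⟨Finset.mem_insert_self _ _, fun h' => hXT y h.2 h'.symm⟩
    · rw [h.1]
      exact ⟨Finset.mem_insert_of_mem (hX h.2), hXT x h.2⟩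
  · intro x hx hxb
    have := key x hx
    rwa [if_neg hxb, add_zero] at this
  · have := key b hb
    rwa [if_pos rfl] at this

lemma supp_sub {T : SimpleGraph V} {k : ℕ} {S : Finset V} {F : SimpleGraph V} {a : V} {e : ℕ}
    (hF : Good T k S F a e) {f : V → V} (hf : IsMt F f) {x : V} (hx : x ∈ supp f) :
    x ∈ S ∧ cnt T S x < k := by
  rw [mem_supp] at hx
  have h := hf.adj x hx
  have hxS := (hF.sub _ _ h).1
  refine ⟨hxS, ?_⟩
  have hpos : 0 < cnt F univ x := (cnt_pos_iff F univ x).mpr ⟨_, Finset.mem_univ _, h⟩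
  by_cases hxa : x = a
  · have := hF.dega
    rw [← hxa] at this
    omega
  · have := hF.deg x hxS hxa
    omega

open Classical in
lemma step {T : SimpleGraph V} (hT : T.IsAcyclic) {k : ℕ} {S : Finset V}
    (hS : k + 1 ≤ S.card) {F : SimpleGraph V} {a : V} {e : ℕ} (hF : Good T k S F a e) {v : V}
    (hvS : v ∉ S) (hv1 : cnt T S v ≤ 1) (hvk : cnt T S v < k) :
    ∃ F2 b2 e2, Good T k (insert v S) F2 b2 e2 := by
  have he := hF.he
  have hda := hF.dega
  have haS := hF.ha
  have hvne : ∀ x ∈ S, x ≠ v := fun x hx h => hvS (h ▸ hx)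
  by_cases hub : ∀ x ∈ S, T.Adj x v → k ≤ cnt T S x
  · have hT1 : ∀ x ∈ S, k - (cnt T S x + if T.Adj x v then 1 else 0) = k - cnt T S x := by
      intro x hx
      by_cases h : T.Adj x v
      · have := hub x hx h
        omega
      · rw [if_neg h, add_zero]
    by_cases hD : Even (k - cnt T S v)
    · have : ∃ f, IsMt F f ∧ (supp f).card = k - cnt T S v := by
        obtain ⟨r, hr⟩ := hD
        rcases Nat.even_or_odd' k with ⟨t, ht | ht⟩
        · obtain ⟨f, hf, hc⟩ := mt_even hT hS hF ht (by omega)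
          exact ⟨f, hf, by omega⟩
        · obtain ⟨f, hf, -, hc⟩ := mt_avoid hT hS hF (by omega)
          exact ⟨f, hf, by omega⟩
      obtain ⟨f, hf, hc⟩ := this
      refine step_good hF hvS hf (X := supp f) (fun x hx => (supp_sub hF hf hx).1) ?_ a e
        (Finset.mem_insert_of_mem hF.ha) he ?_ ?_
      · intro x hx hxv
        have h := supp_sub hF hf hx
        have := hub x h.1 hxv
        omega
      · intro x hx
        rw [hT1 x hx]
        simp only [mem_supp]
        by_cases hxa : x = a
        · subst hxa
          rw [if_pos rfl]
          omega
        · have := hF.deg x hx hxa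
          rw [if_neg hxa]
          omega
      · rw [if_neg (fun h => hvS (by rw [h]; exact haS)), hc, add_zero]
    · obtain ⟨f, hf, hfa, hc⟩ := mt_avoid hT hS hF (by omega)
      rw [Nat.not_even_iff_odd] at hD
      obtain ⟨r, hr⟩ := hD
      have hanotin : a ∉ supp f := by simp [mem_supp, hfa]
      rcases (show e = 0 ∨ e = 1 by omega) with rfl | rfl
      · refine step_good hF hvS hf (X := supp f) (fun x hx => (supp_sub hF hf hx).1) ?_ v 1
          (Finset.mem_insert_self _ _) le_rfl ?_ ?_
        · intro x hx hxv
          have h := supp_sub hF hf hx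
          have := hub x h.1 hxv
          omega
        · intro x hx
          rw [hT1 x hx]
          simp only [mem_supp]
          rw [if_neg (hvne x hx)]
          by_cases hxa : x = a
          · subst hxa
            omega
          · have := hF.deg x hx hxa
            omega
        · rw [if_pos rfl]
          omega
      · refine step_good hF hvS hf (X := insert a (supp f)) ?_ ?_ v 0
          (Finset.mem_insert_self _ _) (by omega) ?_ ?_
        · intro x hx
          rcases Finset.mem_insert.mp hx with rfl | hx
          · exact haS
          · exact (supp_sub hF hf hx).1
        · intro x hx hxv
          rcases Finset.mem_insert.mp hx with rfl | hx
          · have := hub x haS hxv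
            omega
          · have h := supp_sub hF hf hx
            have := hub x h.1 hxv
            omega
        · intro x hx
          rw [hT1 x hx]
          rw [if_neg (hvne x hx)]
          by_cases hxa : x = a
          · subst hxa
            rw [if_pos (Finset.mem_insert_self _ _), if_neg (not_not.mpr hfa)]
            omega
          · have := hF.deg x hx hxa
            simp only [Finset.mem_insert, hxa, false_or, mem_supp]
            omega
        · rw [if_pos rfl, Finset.card_insert_of_notMem hanotin]
          omega
  · push Not at hub
    obtain ⟨u, huS, huv, huk⟩ := hub
    have hv1' : cnt T S v = 1 := by
      have : 0 < cnt T S v := (cnt_pos_iff T S v).mpr ⟨u, huS, huv.symm⟩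
      omega
    have huniq : ∀ x ∈ S, x ≠ u → ¬ T.Adj x v := by
      intro x hx hxu hxv
      have := hv1
      unfold cnt at this
      rw [Finset.card_le_one] at this
      exact hxu (this x (by simp [hx, hxv.symm]) u (by simp [huS, huv.symm]))
    by_cases hua : u = a ∧ e = 1
    · obtain ⟨rfl, rfl⟩ := hua
      obtain ⟨f, hf, hfa, hc⟩ := mt_avoid hT hS hF (by omega)
      refine step_good hF hvS hf (X := supp f) (fun x hx => (supp_sub hF hf hx).1) ?_ v
          (k - 1 - 2 * ((k - 1) / 2))
          (Finset.mem_insert_self _ _) (by omega) ?_ ?_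
      · intro x hx
        refine huniq x (supp_sub hF hf hx).1 ?_
        rintro rfl
        rw [mem_supp] at hx
        exact hx hfa
      · intro x hx
        rw [if_neg (hvne x hx)]
        simp only [mem_supp]
        by_cases hxu : x = u
        · subst hxu
          rw [if_pos huv]
          omega
        · have := hF.deg x hx hxu
          rw [if_neg (huniq x hx hxu)]
          omega
      · rw [if_pos rfl]
        omega
    · rcases Nat.even_or_odd' k with ⟨t, ht | ht⟩
      · obtain ⟨f0, hf0, hc0⟩ := mt_even hT hS hF ht (by omega)
        have hdu : cnt F univ u = k - cnt T S u ∧ (u = a → e = 0) := by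
          by_cases h : u = a
          · have : e = 0 := by
              by_contra h'
              exact hua ⟨h, by omega⟩
            rw [h]
            exact ⟨by omega, fun _ => this⟩
          · exact ⟨hF.deg u huS h, fun h' => absurd h' h⟩
        obtain ⟨w, -, huw⟩ := (cnt_pos_iff F univ u).mp (by omega)
        obtain ⟨f, hf, hc, hfu⟩ := mt_cover hf0 (by omega) huw
        have hus : u ∈ supp f := by rwa [mem_supp]
        refine step_good hF hvS hf (X := (supp f).erase u)
          (fun x hx => (supp_sub hF hf (Finset.mem_of_mem_erase hx)).1) ?_ a e
          (Finset.mem_insert_of_mem hF.ha) he ?_ ?_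
        · intro x hx
          exact huniq x (supp_sub hF hf (Finset.mem_of_mem_erase hx)).1 (Finset.ne_of_mem_erase hx)
        · intro x hx
          by_cases hxu : x = u
          · subst hxu
            rw [if_pos huv, if_pos hfu, if_neg (by simp)]
            have h0 : (if x = a then e else 0) = 0 := by
              by_cases h : x = a
              · rw [if_pos h, hdu.2 h]
              · rw [if_neg h]
            rw [h0]
            omega
          · rw [if_neg (huniq x hx hxu)]
            simp only [Finset.mem_erase, ne_eq, hxu, not_false_eq_true, true_and, mem_supp]
            by_cases hxa : x = a
            · subst hxa
              rw [if_pos rfl]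
              omega
            · have := hF.deg x hx hxa
              rw [if_neg hxa]
              omega
        · rw [if_neg (fun h => hvS (by rw [h]; exact haS))]
          have := Finset.card_erase_add_one hus
          omega
      · obtain ⟨F', a', e', w, hF', ha'u, hwa', huw⟩ := shift hT (by omega) hS hF huS huk hua
        clear hda he haS hua hF
        have he := hF'.he
        have hda := hF'.dega
        have haS := hF'.ha
        obtain ⟨f0, hf0, hc0⟩ := mt_odd hT hS hF' ht
        have huw' : (del F' a').Adj u w := ⟨huw, ha'u.symm, hwa'⟩
        obtain ⟨f, hfd, hc, hfu⟩ := mt_cover hf0 (by omega) huw'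
        obtain ⟨hf, hfa⟩ := hfd.of_del
        have hus : u ∈ supp f := by rwa [mem_supp]
        have hce := Finset.card_erase_add_one hus
        have hdu := hF'.deg u huS ha'u.symm
        have hanotin : a' ∉ (supp f).erase u := by simp [mem_supp, hfa]
        rcases (show e' = 0 ∨ e' = 1 by omega) with rfl | rfl
        · refine step_good hF' hvS hf (X := (supp f).erase u)
            (fun x hx => (supp_sub hF' hf (Finset.mem_of_mem_erase hx)).1) ?_ v 1
            (Finset.mem_insert_self _ _) le_rfl ?_ ?_
          · intro x hx
            exact huniq x (supp_sub hF' hf (Finset.mem_of_mem_erase hx)).1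
              (Finset.ne_of_mem_erase hx)
          · intro x hx
            rw [if_neg (hvne x hx)]
            by_cases hxu : x = u
            · subst hxu
              rw [if_pos huv, if_pos hfu, if_neg (by simp)]
              omega
            · rw [if_neg (huniq x hx hxu)]
              simp only [Finset.mem_erase, ne_eq, hxu, not_false_eq_true, true_and, mem_supp]
              by_cases hxa : x = a'
              · subst hxa
                omega
              · have := hF'.deg x hx hxa
                omega
          · rw [if_pos rfl]
            omega
        · refine step_good hF' hvS hf (X := insert a' ((supp f).erase u))
            ?_ ?_ v 0 (Finset.mem_insert_self _ _) (by omega) ?_ ?_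
          · intro x hx
            rcases Finset.mem_insert.mp hx with rfl | hx
            · exact haS
            · exact (supp_sub hF' hf (Finset.mem_of_mem_erase hx)).1
          · intro x hx
            rcases Finset.mem_insert.mp hx with rfl | hx
            · exact huniq x haS ha'u
            · exact huniq x (supp_sub hF' hf (Finset.mem_of_mem_erase hx)).1
                (Finset.ne_of_mem_erase hx)
          · intro x hx
            rw [if_neg (hvne x hx)]
            by_cases hxu : x = u
            · subst hxu
              rw [if_pos huv, if_pos hfu, if_neg (by simp [ha'u.symm])]
              omega
            · rw [if_neg (huniq x hx hxu)]
              by_cases hxa : x = a'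
              · subst hxa
                rw [if_pos (Finset.mem_insert_self _ _), if_neg (not_not.mpr hfa)]
                omega
              · have := hF'.deg x hx hxa
                simp only [Finset.mem_insert, hxa, false_or, Finset.mem_erase, ne_eq, hxu,
                  not_false_eq_true, true_and, mem_supp]
                omega
          · rw [if_pos rfl, Finset.card_insert_of_notMem hanotin]
            omega

/-- complement of `T` inside `S` -/
def comp (T : SimpleGraph V) (S : Finset V) : SimpleGraph V where
  Adj x y := x ≠ y ∧ x ∈ S ∧ y ∈ S ∧ ¬ T.Adj x y
  symm := ⟨fun _ _ h => ⟨h.1.symm, h.2.2.1, h.2.1, fun h' => h.2.2.2 h'.symm⟩⟩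
  loopless := ⟨fun _ h => h.1 rfl⟩

lemma exists_good {T : SimpleGraph V} (hT : T.IsAcyclic) {k : ℕ} (hk : 1 ≤ k) :
    ∀ (j : ℕ) (S : Finset V), S.card = k + 1 + j → ∃ F a e, Good T k S F a e := by
  classical
  intro j
  induction j with
  | zero =>
    intro S hS
    obtain ⟨a, ha⟩ := Finset.card_pos.mp (show 0 < S.card by omega)
    have key : ∀ x ∈ S, cnt (comp T S) univ x = k - cnt T S x := by
      intro x hx
      have h1 : univ.filter (fun y => (comp T S).Adj x y) =
          (S.erase x) \ S.filter (fun y => T.Adj x y) := by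
        ext y
        simp only [Finset.mem_filter, Finset.mem_univ, true_and, Finset.mem_sdiff,
          Finset.mem_erase]
        change (x ≠ y ∧ x ∈ S ∧ y ∈ S ∧ ¬ T.Adj x y) ↔ _
        have : x ≠ y ↔ y ≠ x := ne_comm
        tauto
      have h2 : S.filter (fun y => T.Adj x y) ⊆ S.erase x := by
        intro y hy
        simp only [Finset.mem_filter, Finset.mem_erase] at hy ⊢
        exact ⟨hy.2.ne', hy.1⟩
      have h3 := Finset.card_erase_add_one hx
      unfold cnt
      rw [h1, Finset.card_sdiff_of_subset h2]
      omega
    exact ⟨comp T S, a, 0, fun x y h => ⟨h.2.1, h.2.2.2⟩, ha, by omega, fun x hx _ => key x hx,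
      key a ha⟩
  | succ j ih =>
    intro S hS
    by_cases hall : ∀ x ∈ S, k ≤ cnt T S x
    · obtain ⟨a, ha⟩ := Finset.card_pos.mp (show 0 < S.card by omega)
      have h0 : ∀ x, cnt (⊥ : SimpleGraph V) univ x = 0 := by
        intro x
        simp [cnt]
      refine ⟨⊥, a, 0, fun x y h => absurd h (by simp), ha, by omega, ?_, ?_⟩
      · intro x hx _
        have := hall x hx
        rw [h0]; omega
      · have := hall a ha
        rw [h0]; omega
    · have : ∃ v ∈ S, cnt T S v ≤ 1 ∧ cnt T S v < k := by
        push Not at hall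
        obtain ⟨x, hx, hxk⟩ := hall
        obtain ⟨v, hv, hv1⟩ := exists_leaf T hT S ⟨x, hx⟩
        by_cases h : cnt T S v < k
        · exact ⟨v, hv, hv1, h⟩
        · exact ⟨x, hx, by omega, hxk⟩
      obtain ⟨v, hv, hv1, hvk⟩ := this
      have hc := Finset.card_erase_add_one hv
      obtain ⟨F, a, e, hF⟩ := ih (S.erase v) (by omega)
      have hn : v ∉ S.erase v := by simp
      have hcnt := cnt_insert T hn v
      rw [Finset.insert_erase hv] at hcnt
      simp only [SimpleGraph.irrefl, if_false, add_zero] at hcnt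
      have := step hT (by omega) hF hn (by omega) (by omega)
      rwa [Finset.insert_erase hv] at this

lemma ncard_nbr (G : SimpleGraph V) (v : V) : (G.neighborSet v).ncard = cnt G univ v := by
  classical
  unfold cnt
  rw [← Set.ncard_coe_finset]
  congr 1
  ext y
  simp

lemma sum_cnt (G : SimpleGraph V) : ∑ v, cnt G univ v = 2 * G.edgeSet.ncard := by
  classical
  have h := G.sum_degrees_eq_twice_card_edges
  rw [← SimpleGraph.coe_edgeFinset, Set.ncard_coe_finset, ← h]
  apply Finset.sum_congr rfl
  intro v _
  rw [← SimpleGraph.card_neighborFinset_eq_degree, ← Set.ncard_coe_finset, ← ncard_nbr,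
    SimpleGraph.coe_neighborFinset]

lemma finish {T F : SimpleGraph V} {k m : ℕ} (hd : ∀ x y, F.Adj x y → ¬ T.Adj x y)
    (hdeg : ∀ x, k ≤ cnt T univ x + cnt F univ x) (hm : F.edgeSet.ncard = m) :
    ∃ E : Set (Sym2 V), E.ncard = m ∧ (∀ e ∈ E, ¬ e.IsDiag) ∧ Disjoint E T.edgeSet ∧
      ∀ v : V, k ≤ ((T ⊔ SimpleGraph.fromEdgeSet E).neighborSet v).ncard := by
  classical
  refine ⟨F.edgeSet, hm, fun e he => F.not_isDiag_of_mem_edgeSet he, ?_, ?_⟩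
  · rw [Set.disjoint_left]
    intro e
    induction e using Sym2.ind with
    | _ x y =>
      intro h1 h2
      exact hd x y h1 h2
  · intro v
    rw [SimpleGraph.fromEdgeSet_edgeSet, ncard_nbr]
    refine (hdeg v).trans ?_
    unfold cnt
    rw [← Finset.card_union_of_disjoint]
    · apply Finset.card_le_card
      intro y
      simp
    · rw [Finset.disjoint_left]
      intro y h1 h2
      simp only [Finset.mem_filter, Finset.mem_univ, true_and] at h1 h2
      exact hd v y h2 h1

lemma main_aux (k : ℕ) (hk : 1 ≤ k) (T : SimpleGraph V) (hT : T.IsAcyclic)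
    (hn : k + 1 ≤ Fintype.card V) :
    ∃ F : Set (Sym2 V),
      F.ncard = ((∑ v : V, (k - (T.neighborSet v).ncard)) + 1) / 2 ∧
      (∀ e ∈ F, ¬ e.IsDiag) ∧
      Disjoint F T.edgeSet ∧
      ∀ v : V, k ≤ ((T ⊔ SimpleGraph.fromEdgeSet F).neighborSet v).ncard := by
  classical
  obtain ⟨F, a, e, hF⟩ := exists_good hT hk (Fintype.card V - (k + 1)) univ
    (by rw [Finset.card_univ]; omega)
  have he := hF.he
  have hda := hF.dega
  have hsum : ∑ v : V, (k - (T.neighborSet v).ncard) = 2 * F.edgeSet.ncard + e := by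
    rw [← sum_cnt]
    have : ∀ v : V, k - (T.neighborSet v).ncard = cnt F univ v + if v = a then e else 0 := by
      intro v
      rw [ncard_nbr]
      by_cases h : v = a
      · subst h
        rw [if_pos rfl]; omega
      · have := hF.deg v (Finset.mem_univ _) h
        rw [if_neg h]; omega
    simp only [this, Finset.sum_add_distrib]
    simp
  rw [hsum]
  rcases (show e = 0 ∨ e = 1 by omega) with rfl | rfl
  · refine finish (F := F) (fun x y h => (hF.sub x y h).2) ?_ (by omega)
    intro x
    by_cases h : x = a
    · subst h
      omega
    · have := hF.deg x (Finset.mem_univ _) h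
      omega
  · have : ∃ b, b ≠ a ∧ ¬ F.Adj a b ∧ ¬ T.Adj a b := by
      by_contra hno
      push Not at hno
      have h1 : (univ : Finset V) ⊆
          insert a (univ.filter (fun p => F.Adj a p) ∪ univ.filter (fun p => T.Adj a p)) := by
        intro p _
        simp only [Finset.mem_insert, Finset.mem_union, Finset.mem_filter, Finset.mem_univ,
          true_and]
        have := hno p
        tauto
      have h2 := Finset.card_le_card h1
      have h3 := Finset.card_insert_le a
        (univ.filter (fun p => F.Adj a p) ∪ univ.filter (fun p => T.Adj a p))
      have h5 := Finset.card_union_le (univ.filter (fun p => F.Adj a p))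
        (univ.filter (fun p => T.Adj a p))
      unfold cnt at hda
      rw [Finset.card_univ] at h2
      omega
    obtain ⟨b, hba, hbF, hbT⟩ := this
    have hc := cnt_addE F a b hba.symm hbF
    have hs := sum_cnt (addE F a b hba.symm)
    simp only [hc, Finset.sum_add_distrib, sum_cnt] at hs
    simp at hs
    refine finish (F := addE F a b hba.symm) ?_ ?_ (by omega)
    · intro x y h
      rcases h with h | ⟨rfl, rfl⟩ | ⟨rfl, rfl⟩
      · exact (hF.sub x y h).2
      · exact hbT
      · exact fun h => hbT h.symm
    · intro x
      rw [hc]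
      by_cases h : x = a
      · subst h
        rw [if_pos rfl]
        omega
      · have := hF.deg x (Finset.mem_univ _) h
        omega

end
end ForestCompletion


/-- For every integer `k ≥ 1` and every forest `T` on at least `k+1` vertices, there exists a
set `F` of exactly `⌈df(T)/2⌉` edges on `V(T)`, disjoint from `E(T)`, such that `T + F` has
minimum degree at least `k`. -/
theorem forest_completion_exists {V : Type*} [Fintype V]
    (k : ℕ) (hk : 1 ≤ k) (T : SimpleGraph V) (hT : T.IsAcyclic)
    (hn : k + 1 ≤ Fintype.card V) :
    ∃ F : Set (Sym2 V),
      F.ncard = ((∑ v : V, (k - (T.neighborSet v).ncard)) + 1) / 2 ∧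
      (∀ e ∈ F, ¬ e.IsDiag) ∧
      Disjoint F T.edgeSet ∧
      ∀ v : V, k ≤ ((T ⊔ SimpleGraph.fromEdgeSet F).neighborSet v).ncard := by
  exact ForestCompletion.main_aux k hk T hT hn
end

section
/- For every integer k ≥ 4 and every forest T on at least k+1 vertices, there exists a set F of exactly ⌈ df(T)/2 ⌉ edges on V(T), disjoint from E(T), such that the graph T + F has minimum degree at least k and, moreover, the graph whose edge set is F, restricted to the vertices covered by F, is connected. -/
set_option linter.unusedSectionVars false

section

open SimpleGraph Finset

namespace ForestC

variable {V : Type*} [Fintype V]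

/-- the finite set of neighbours -/
noncomputable def nb (G : SimpleGraph V) (v : V) : Finset V := by
  classical exact Finset.univ.filter (fun u => G.Adj v u)

theorem mem_nb {G : SimpleGraph V} {v u : V} : u ∈ nb G v ↔ G.Adj v u := by
  classical simp [nb]

/-- degree -/
noncomputable def dg (G : SimpleGraph V) (v : V) : ℕ := (nb G v).card

theorem dg_eq (G : SimpleGraph V) (v : V) : (G.neighborSet v).ncard = dg G v := by
  classical
  have : G.neighborSet v = (nb G v : Set V) := by ext u; simp [mem_nb]
  rw [this, Set.ncard_coe_finset, dg]

theorem sum_dg (G : SimpleGraph V) : ∑ v, dg G v = 2 * G.edgeSet.ncard := by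
  classical
  have h := G.sum_degrees_eq_twice_card_edges
  have h2 : G.edgeSet.ncard = G.edgeFinset.card := by
    rw [← coe_edgeFinset, Set.ncard_coe_finset]
  rw [h2, ← h]
  refine Finset.sum_congr rfl fun v _ => ?_
  rw [← G.card_neighborFinset_eq_degree, dg]
  congr 1
  ext u; simp [mem_nb]

theorem acyclic_sum {G : SimpleGraph V} (h : G.IsAcyclic) [Nonempty V] :
    ∑ v, dg G v + 2 ≤ 2 * Fintype.card V := by
  classical
  obtain ⟨T, hT, -, hle⟩ :=
    (connected_top (V := V)).exists_isTree_le_of_le_of_isAcyclic (H := G) le_top h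
  have h1 := hle.card_edgeFinset
  have h2 : G.edgeSet.ncard ≤ T.edgeSet.ncard :=
    Set.ncard_le_ncard (edgeSet_mono ‹G ≤ T›) (Set.toFinite _)
  have h3 : T.edgeSet.ncard = T.edgeFinset.card := by
    rw [← coe_edgeFinset, Set.ncard_coe_finset]
  rw [sum_dg]
  omega

open Classical in
theorem acyclic_sum_on {T : SimpleGraph V} (h : T.IsAcyclic) (X : Finset V) (hX : X.Nonempty) :
    ∑ v ∈ X, (nb T v ∩ X).card + 2 ≤ 2 * X.card := by
  have h1 := h.induce (X : Set V)
  obtain ⟨x, hx⟩ := hX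
  have : Nonempty (X : Set V) := ⟨⟨x, hx⟩⟩
  have h2 := acyclic_sum h1
  have h3 : Fintype.card (X : Set V) = X.card := by simp
  rw [h3] at h2
  have h4 : ∑ v : (X : Set V), dg (T.induce (X : Set V)) v = ∑ v ∈ X, (nb T v ∩ X).card := by
    rw [← Finset.sum_coe_sort X]
    refine Finset.sum_congr rfl fun v _ => ?_
    rw [dg]
    rw [← Finset.card_map (Function.Embedding.subtype _)]
    congr 1
    ext u
    simp [mem_nb]
  omega

theorem acyclic_low {T : SimpleGraph V} (h : T.IsAcyclic) (X : Finset V) (hX : X.Nonempty)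
    (h2 : ∀ x ∈ X, ∃ a b, a ≠ b ∧ a ∈ X ∧ b ∈ X ∧ T.Adj x a ∧ T.Adj x b) : False := by
  classical
  have h3 := acyclic_sum_on h X hX
  have h4 : ∑ v ∈ X, 2 ≤ ∑ v ∈ X, (nb T v ∩ X).card := by
    refine Finset.sum_le_sum fun v hv => ?_
    obtain ⟨a, b, hab, ha, hb, h5, h6⟩ := h2 v hv
    have : ({a, b} : Finset V) ⊆ nb T v ∩ X := by
      intro c hc
      simp at hc
      rcases hc with rfl | rfl <;> simp [mem_nb, *]
    calc 2 = ({a, b} : Finset V).card := by rw [Finset.card_pair hab]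
      _ ≤ _ := Finset.card_le_card this
  simp at h4
  omega

end ForestC

namespace ForestC

variable {V : Type*} [Fintype V]

/-- add an edge -/
def ad (G : SimpleGraph V) (u v : V) : SimpleGraph V := G ⊔ fromEdgeSet {s(u, v)}

/-- delete an edge -/
def dl (G : SimpleGraph V) (u v : V) : SimpleGraph V := G.deleteEdges {s(u, v)}

theorem ad_adj {G : SimpleGraph V} {u v a b : V} (h : u ≠ v) : (ad G u v).Adj a b ↔
    G.Adj a b ∨ (a = u ∧ b = v) ∨ (a = v ∧ b = u) := by
  simp only [ad, sup_adj, fromEdgeSet_adj, Set.mem_singleton_iff, Sym2.eq_iff]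
  grind

theorem dl_adj {G : SimpleGraph V} {u v a b : V} : (dl G u v).Adj a b ↔
    G.Adj a b ∧ ¬ ((a = u ∧ b = v) ∨ (a = v ∧ b = u)) := by
  simp only [dl, deleteEdges_adj, Set.mem_singleton_iff, Sym2.eq_iff]

open Classical in
theorem dg_ad {G : SimpleGraph V} {u v : V} (h : u ≠ v) (h2 : ¬ G.Adj u v) (c : V) :
    dg (ad G u v) c = dg G c + (if c = u then 1 else 0) + (if c = v then 1 else 0) := by
  have h3 : ¬ G.Adj v u := fun h => h2 h.symm
  by_cases h4 : c = u
  · subst h4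
    have : nb (ad G c v) c = insert v (nb G c) := by
      ext a; simp only [mem_nb, ad_adj h, Finset.mem_insert]; grind
    rw [dg, this, Finset.card_insert_of_notMem (by rwa [mem_nb])]
    simp [h, dg]
  by_cases h5 : c = v
  · subst h5
    have : nb (ad G u c) c = insert u (nb G c) := by
      ext a; simp only [mem_nb, ad_adj h, Finset.mem_insert]; grind
    rw [dg, this, Finset.card_insert_of_notMem (by rwa [mem_nb])]
    simp [h4, dg]
  have : nb (ad G u v) c = nb G c := by
    ext a; simp only [mem_nb, ad_adj h]; grind
  simp [dg, this, h4, h5]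

open Classical in
theorem dg_dl {G : SimpleGraph V} {u v : V} (h2 : G.Adj u v) (c : V) :
    dg (dl G u v) c + (if c = u then 1 else 0) + (if c = v then 1 else 0) = dg G c := by
  have h : u ≠ v := h2.ne
  have h3 : G = ad (dl G u v) u v := by
    ext a b
    rw [ad_adj h, dl_adj]
    have := h2.symm
    grind
  conv_rhs => rw [h3]
  rw [dg_ad h]
  rw [dl_adj]; simp

/-- disjointness of edge sets -/
def Dj (T F : SimpleGraph V) : Prop := ∀ u v, F.Adj u v → ¬ T.Adj u v

open Classical in
theorem phase1 (k : ℕ) (T : SimpleGraph V) (hT : T.IsAcyclic) (hn : k + 1 ≤ Fintype.card V) :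
    ∃ F : SimpleGraph V, Dj T F ∧ (∀ v, k ≤ dg T v + dg F v) ∧
      F.edgeSet.ncard = (∑ v, (k - dg T v) + 1) / 2 := by
  obtain ⟨F, ⟨hdj, hle⟩, hmax⟩ := Set.exists_max_image
    {F : SimpleGraph V | Dj T F ∧ ∀ v, dg F v ≤ k - dg T v} (fun F => ∑ v, dg F v)
    (Set.toFinite _) ⟨⊥, by
      refine ⟨fun u v h => by simp at h, fun v => ?_⟩
      have : nb (⊥ : SimpleGraph V) v = ∅ := by ext; simp [mem_nb]
      simp [dg, this]⟩
  have key : ∀ F' : SimpleGraph V, Dj T F' → ∀ u v : V,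
      (∀ c, dg F' c = dg F c + (if c = u then 1 else 0) + (if c = v then 1 else 0)) →
      dg F u < k - dg T u → dg F v < k - dg T v → (u = v → dg F u + 1 < k - dg T u) → False := by
    intro F' h1 u v h2 h3 h4 h5
    have h6 := hmax F' ⟨h1, fun c => ?_⟩
    · have : ∑ c, dg F' c = ∑ c, dg F c + 1 + 1 := by
        simp only [h2, Finset.sum_add_distrib]
        simp
      omega
    · rw [h2]
      have := hle c
      by_cases hu : c = u
      · subst hu
        by_cases hv : c = v
        · subst hv
          have := h5 rfl
          simp; omega
        · simp [hv]; omega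
      · by_cases hv : c = v
        · subst hv
          simp [hu]; omega
        · simp [hu, hv]; omega
  have clique : ∀ u v, u ≠ v → dg F u < k - dg T u → dg F v < k - dg T v → ¬ T.Adj u v →
      ¬ F.Adj u v → False := by
    intro u v huv h1 h2 h3 h4
    refine key (ad F u v) ?_ u v (dg_ad huv h4) h1 h2 (fun h => absurd h huv)
    intro a b hab
    rw [ad_adj huv] at hab
    have h3' : ¬ T.Adj v u := fun h => h3 h.symm
    rcases hab with hab | ⟨rfl, rfl⟩ | ⟨rfl, rfl⟩
    · exact hdj _ _ hab
    · exact h3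
    · exact h3'
  let A : V → Finset V := fun u => Finset.univ.filter fun x => x ≠ u ∧ ¬ T.Adj u x ∧ ¬ F.Adj u x
  have memA : ∀ u x, x ∈ A u ↔ x ≠ u ∧ ¬ T.Adj u x ∧ ¬ F.Adj u x := by
    intro u x; simp [A]
  have nbdisj : ∀ x, Disjoint (nb T x) (nb F x) := by
    intro x
    rw [Finset.disjoint_left]
    intro a ha hb
    rw [mem_nb] at ha hb
    exact hdj _ _ hb ha
  have compA : ∀ u, (Finset.univ \ A u) = insert u (nb T u ∪ nb F u) := by
    intro u
    ext x
    simp only [Finset.mem_sdiff, Finset.mem_univ, true_and, memA, Finset.mem_insert,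
      Finset.mem_union, mem_nb]
    tauto
  have cardB : ∀ u, (Finset.univ \ A u).card = dg T u + dg F u + 1 := by
    intro u
    rw [compA, Finset.card_insert_of_notMem (by simp [mem_nb]),
      Finset.card_union_of_disjoint (nbdisj u)]
    rfl
  have Ane : ∀ u, dg F u < k - dg T u → (A u).Nonempty := by
    intro u hu
    rw [Finset.nonempty_iff_ne_empty]
    intro h
    have := cardB u
    rw [h] at this
    simp at this
    omega
  have step : ∀ u v, dg F u < k - dg T u → dg F v < k - dg T v →
      (u = v → dg F u + 1 < k - dg T u) → 
      (∀ x ∈ A u, ∀ y ∈ A v, ¬ F.Adj x y) → ∀ x ∈ A u, ∃ a b, a ≠ b ∧ a ∈ A v ∧ b ∈ A v ∧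
        T.Adj x a ∧ T.Adj x b := by
    intro u v hu hv huv hno x hx
    have hx' := (memA _ _).1 hx
    have hrx : ¬ dg F x < k - dg T x := fun h =>
      clique u x hx'.1.symm hu h hx'.2.1 hx'.2.2
    have h1 : nb T x ∪ nb F x ⊆ (nb T x ∩ A v) ∪ (((Finset.univ \ A v).erase u).erase 
      (if x ∈ A v then v else x)) := by
      intro a ha
      simp only [Finset.mem_union, mem_nb] at ha
      by_cases hav : a ∈ A v
      · rcases ha with ha | ha
        · simp [mem_nb, ha, hav]
        · exact absurd ha (hno x hx a hav)
      · have h2 : a ≠ u := by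
          rintro rfl
          rcases ha with ha | ha
          · exact hx'.2.1 ha.symm
          · exact hx'.2.2 ha.symm
        have h3 : a ≠ (if x ∈ A v then v else x) := by
          split_ifs with h
          · rintro rfl
            have := (memA _ _).1 h
            rcases ha with ha | ha
            · exact this.2.1 ha.symm
            · exact this.2.2 ha.symm
          · rintro rfl
            rcases ha with ha | ha
            · exact ha.ne rfl
            · exact ha.ne rfl
        simp [hav, h2, h3]
    have h2 := Finset.card_le_card h1
    rw [Finset.card_union_of_disjoint (nbdisj x)] at h2
    have h3 := h2.trans (Finset.card_union_le _ _)
    have h4 : (((Finset.univ \ A v).erase u).erase (if x ∈ A v then v else x)).card + 2 ≤ k := by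
      by_cases huv' : u = v
      · subst huv'
        have := huv rfl
        have h5 := Finset.card_erase_le (s := (Finset.univ \ A u).erase u)
          (a := (if x ∈ A u then u else x))
        have h6 : ((Finset.univ \ A u).erase u).card + 1 = (Finset.univ \ A u).card := 
          Finset.card_erase_add_one (by simp [memA])
        rw [cardB] at h6
        omega
      · have huB : u ∈ Finset.univ \ A v := by
          simp only [Finset.mem_sdiff, Finset.mem_univ, true_and, memA]
          rintro ⟨h7, h8, h9⟩
          exact clique v u (Ne.symm huv') hv hu h8 h9
        have h6 := Finset.card_erase_add_one huB
        have h7 : (if x ∈ A v then v else x) ∈ (Finset.univ \ A v).erase u := by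
          split_ifs with h
          · simp [memA, Ne.symm huv']
          · simp [h, hx'.1]
        have h8 := Finset.card_erase_add_one h7
        rw [cardB] at h6
        omega
    have h5 : 1 < (nb T x ∩ A v).card := by
      have : k ≤ dg T x + dg F x := by omega
      simp only [dg] at this
      omega
    obtain ⟨a, ha, b, hb, hab⟩ := Finset.one_lt_card.1 h5
    simp only [Finset.mem_inter, mem_nb] at ha hb
    exact ⟨a, b, hab, ha.2, hb.2, ha.1, hb.1⟩
  have main : ∀ u v, dg F u < k - dg T u → dg F v < k - dg T v →
      (u = v → dg F u + 1 < k - dg T u) → False := by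
    intro u v hu hv huv
    by_cases hno : ∀ x ∈ A u, ∀ y ∈ A v, ¬ F.Adj x y
    · have s1 := step u v hu hv huv hno
      have s2 := step v u hv hu (fun h => by have := huv h.symm; rw [h]; exact this) 
        (fun x hx y hy h => hno y hy x hx h.symm)
      refine acyclic_low hT (A u ∪ A v) ((Ane u hu).mono Finset.subset_union_left) ?_
      intro x hx
      rw [Finset.mem_union] at hx
      rcases hx with hx | hx
      · obtain ⟨a, b, h1, h2, h3, h4, h5⟩ := s1 x hx
        exact ⟨a, b, h1, Finset.mem_union_right _ h2, Finset.mem_union_right _ h3, h4, h5⟩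
      · obtain ⟨a, b, h1, h2, h3, h4, h5⟩ := s2 x hx
        exact ⟨a, b, h1, Finset.mem_union_left _ h2, Finset.mem_union_left _ h3, h4, h5⟩
    · push Not at hno
      obtain ⟨x, hx, y, hy, hxy⟩ := hno
      have hx' := (memA _ _).1 hx
      have hy' := (memA _ _).1 hy
      have hxv : x ≠ v := by
        rintro rfl
        exact clique u x hx'.1.symm hu hv hx'.2.1 hx'.2.2
      have hyu : y ≠ u := by
        rintro rfl
        exact clique v y hy'.1.symm hv hu hy'.2.1 hy'.2.2
      have e1 : ¬ (dl F x y).Adj u x := by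
        rw [dl_adj]; exact fun h => hx'.2.2 h.1
      have e2 : ¬ (ad (dl F x y) u x).Adj v y := by
        rw [ad_adj hx'.1.symm, dl_adj]
        rintro (h | h | h)
        · exact hy'.2.2 h.1
        · exact hxy.ne h.2.symm
        · exact hxv h.1.symm
      refine key (ad (ad (dl F x y) u x) v y) ?_ u v ?_ hu hv huv
      · intro a b hab
        rw [ad_adj hy'.1.symm, ad_adj hx'.1.symm, dl_adj] at hab
        rcases hab with (hab | ⟨rfl, rfl⟩ | ⟨rfl, rfl⟩) | ⟨rfl, rfl⟩ | ⟨rfl, rfl⟩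
        · exact hdj _ _ hab.1
        · exact hx'.2.1
        · exact fun h => hx'.2.1 h.symm
        · exact hy'.2.1
        · exact fun h => hy'.2.1 h.symm
      · intro c
        rw [dg_ad hy'.1.symm e2, dg_ad hx'.1.symm e1, ← dg_dl hxy c]
        omega
  by_cases hall : ∀ v, dg F v = k - dg T v
  · refine ⟨F, hdj, fun v => by have := hall v; omega, ?_⟩
    have := sum_dg F
    simp only [hall] at this
    omega
  · push Not at hall
    obtain ⟨u, hu⟩ := hall
    have hu1 : dg F u < k - dg T u := lt_of_le_of_ne (hle u) hu
    have hu2 : dg F u + 1 = k - dg T u := by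
      by_contra h
      exact main u u hu1 hu1 (fun _ => by omega)
    have hoth : ∀ v, v ≠ u → dg F v = k - dg T v := by
      intro v hv
      by_contra h
      exact main u v hu1 (lt_of_le_of_ne (hle v) h) (fun h => absurd h.symm hv)
    obtain ⟨x, hx⟩ := Ane u hu1
    have hx' := (memA _ _).1 hx
    refine ⟨ad F u x, ?_, ?_, ?_⟩
    · intro a b hab
      rw [ad_adj hx'.1.symm] at hab
      rcases hab with hab | ⟨rfl, rfl⟩ | ⟨rfl, rfl⟩
      · exact hdj _ _ hab
      · exact hx'.2.1
      · exact fun h => hx'.2.1 h.symm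
    · intro v
      rw [dg_ad hx'.1.symm hx'.2.2]
      by_cases hv : v = u
      · subst hv; simp; omega
      · have := hoth v hv
        omega
    · have h1 := sum_dg (ad F u x)
      simp only [dg_ad hx'.1.symm hx'.2.2, Finset.sum_add_distrib] at h1
      have h2 : ∑ v, (k - dg T v) = ∑ v, dg F v + 1 := by
        have : ∀ v, k - dg T v = dg F v + (if v = u then 1 else 0) := by
          intro v
          by_cases hv : v = u
          · subst hv; simp; omega
          · simp [hv, hoth v hv]
        simp only [this, Finset.sum_add_distrib]
        simp
      simp at h1
      omega

end ForestC

namespace ForestC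

variable {V : Type*} [Fintype V]

theorem dl_comm' (G : SimpleGraph V) (u v : V) : dl G u v = dl G v u := by
  rw [dl, dl, Sym2.eq_swap]

theorem dl_le (G : SimpleGraph V) (u v : V) : dl G u v ≤ G := fun _ _ h => (dl_adj.1 h).1

/-- induction over reachability -/
theorem reach_induct {G : SimpleGraph V} {x : V} {P : V → Prop} (h0 : P x)
    (hs : ∀ a b, G.Reachable x a → P a → G.Adj a b → P b) {y : V} (h : G.Reachable x y) : P y := by
  rw [reachable_iff_reflTransGen] at h
  induction h with
  | refl => exact h0
  | tail h1 h2 ih =>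
    exact hs _ _ ((reachable_iff_reflTransGen _ _).2 h1) ih h2

theorem reach_of_adj {G G' : SimpleGraph V} (h : ∀ a b, G.Adj a b → G'.Reachable a b) {x y : V}
    (hr : G.Reachable x y) : G'.Reachable x y :=
  reach_induct (P := fun y => G'.Reachable x y) (Reachable.refl _)
    (fun a b _ h1 h2 => h1.trans (h a b h2)) hr

/-- local version -/
theorem reach_of_adj_local {G G' : SimpleGraph V} {x y : V}
    (h : ∀ a b, G.Reachable x a → G.Adj a b → G'.Reachable a b) 
    (hr : G.Reachable x y) : G'.Reachable x y :=
  reach_induct (P := fun y => G'.Reachable x y) (Reachable.refl _)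
    (fun a b h0 h1 h2 => h1.trans (h a b h0 h2)) hr

theorem reach_first {G : SimpleGraph V} {a x : V} (h : G.Reachable a x) (hne : a ≠ x) :
    ∃ p, G.Adj a p ∧ (G.deleteIncidenceSet a).Reachable p x := by
  classical
  obtain ⟨p, hp⟩ := h.exists_isPath
  cases p with
  | nil => exact absurd rfl hne
  | @cons _ b _ hadj q =>
    refine ⟨b, hadj, ?_⟩
    rw [Walk.cons_isPath_iff] at hp
    clear hadj
    have h2 := hp.2
    clear hp h
    induction q with
    | nil => exact Reachable.refl _
    | @cons u v w h3 q ih =>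
      simp only [Walk.support_cons, List.mem_cons, not_or] at h2
      refine Reachable.trans (Adj.reachable ?_) (ih hne h2.2)
      rw [deleteIncidenceSet_adj]
      refine ⟨h3, Ne.symm h2.1, ?_⟩
      rintro rfl
      exact h2.2 (Walk.start_mem_support _)

theorem reach_parent {G : SimpleGraph V} {a x : V} (h : G.Reachable a x) (hne : a ≠ x) :
    ∃ p, G.Adj a p ∧ ∀ b, b ≠ p → (dl G a b).Reachable a x := by
  obtain ⟨p, h1, h2⟩ := reach_first h hne
  refine ⟨p, h1, fun b hb => ?_⟩
  have h3 : (dl G a b).Adj a p := by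
    rw [dl_adj]; refine ⟨h1, ?_⟩
    rintro (h | h)
    · exact hb h.2.symm
    · exact h1.ne h.2.symm
  refine h3.reachable.trans (h2.mono ?_)
  intro u v huv
  rw [deleteIncidenceSet_adj] at huv
  rw [dl_adj]
  grind

/-- non-bridge edge -/
def NB (F : SimpleGraph V) (x y : V) : Prop := F.Adj x y ∧ (dl F x y).Reachable x y

theorem NB.symm {F : SimpleGraph V} {x y : V} (h : NB F x y) : NB F y x := by
  refine ⟨h.1.symm, ?_⟩
  rw [dl_comm']; exact h.2.symm

theorem NB.next {F : SimpleGraph V} {x y : V} (h : NB F x y) : ∃ y2, y2 ≠ x ∧ NB F y y2 := by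
  obtain ⟨p, h1, h2⟩ := reach_first h.2.symm h.1.ne.symm
  rw [dl_adj] at h1
  have hpx : p ≠ x := fun h => h1.2 (Or.inr ⟨rfl, h⟩)
  refine ⟨p, hpx, h1.1, ?_⟩
  have h3 : (dl F y p).Adj y x := by
    rw [dl_adj]; refine ⟨h.1.symm, ?_⟩
    rintro (h | h)
    · exact hpx h.2.symm
    · exact h1.1.ne h.1
  refine h3.reachable.trans (Reachable.symm (h2.mono ?_))
  intro u v huv
  rw [deleteIncidenceSet_adj, dl_adj] at huv
  rw [dl_adj]
  grind

theorem exists_NB {F : SimpleGraph V} (h : ¬ F.IsAcyclic) : ∃ x y, NB F x y := by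
  rw [isAcyclic_iff_forall_adj_isBridge] at h
  push Not at h
  obtain ⟨x, y, h1, h2⟩ := h
  refine ⟨x, y, h1, ?_⟩
  rw [isBridge_iff, not_not] at h2
  exact h2

/-- two neighbours of `w` are not joined avoiding `w` -/
theorem pfa {T : SimpleGraph V} (hT : T.IsAcyclic) {w p q : V} (hp : T.Adj w p) (hq : T.Adj w q)
    (hpq : p ≠ q) (h : (T.deleteIncidenceSet w).Reachable p q) : False := by
  rw [isAcyclic_iff_forall_adj_isBridge] at hT
  have h1 := hT hp
  rw [isBridge_iff] at h1
  apply h1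
  have h3 : (dl T w p).Adj w q := by
    rw [dl_adj]; refine ⟨hq, ?_⟩
    rintro (h | h)
    · exact hpq h.2.symm
    · exact hp.ne h.1
  refine h3.reachable.trans (Reachable.symm (h.mono ?_))
  intro u v huv
  rw [deleteIncidenceSet_adj] at huv
  rw [dl_adj]
  grind

theorem noC4 {T : SimpleGraph V} (hT : T.IsAcyclic) {a b c d : V} (hab : a ≠ b) (hcd : c ≠ d)
    (h1 : T.Adj a c) (h2 : T.Adj b c) (h3 : T.Adj a d) (h4 : T.Adj b d) : False := by
  refine pfa hT h1 h3 hcd ?_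
  have e1 : (T.deleteIncidenceSet a).Adj c b := by
    rw [deleteIncidenceSet_adj]; exact ⟨h2.symm, h1.ne.symm, hab.symm⟩
  have e2 : (T.deleteIncidenceSet a).Adj b d := by
    rw [deleteIncidenceSet_adj]; exact ⟨h4, hab.symm, h3.ne.symm⟩
  exact e1.reachable.trans e2.reachable

/-- number of components -/
noncomputable def cc (G : SimpleGraph V) : ℕ := Nat.card G.ConnectedComponent

theorem cc_le {G G' : SimpleGraph V} (h : ∀ a b, G.Adj a b → G'.Reachable a b) :
    cc G' ≤ cc G := by
  refine Nat.card_le_card_of_surjective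
    (fun c : G.ConnectedComponent => G'.connectedComponentMk c.out) ?_
  intro c
  induction c using ConnectedComponent.ind with
  | _ u =>
    refine ⟨G.connectedComponentMk u, ?_⟩
    rw [ConnectedComponent.eq]
    apply reach_of_adj h
    rw [← ConnectedComponent.eq]
    exact Quot.out_eq _

theorem cc_lt {G G' : SimpleGraph V} (h : ∀ a b, G.Adj a b → G'.Reachable a b) {x z : V}
    (h1 : G'.Reachable x z) (h2 : ¬ G.Reachable x z) : cc G' < cc G := by
  refine lt_of_le_of_ne (cc_le h) fun heq => ?_
  have hsurj : Function.Surjective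
      (fun c : G.ConnectedComponent => G'.connectedComponentMk c.out) := by
    intro c
    induction c using ConnectedComponent.ind with
    | _ u =>
      refine ⟨G.connectedComponentMk u, ?_⟩
      rw [ConnectedComponent.eq]
      apply reach_of_adj h
      rw [← ConnectedComponent.eq]
      exact Quot.out_eq _
  have hbij := (Nat.bijective_iff_surjective_and_card
      (fun c : G.ConnectedComponent => G'.connectedComponentMk c.out)).2 ⟨hsurj, heq.symm⟩
  apply h2
  rw [← ConnectedComponent.eq]
  apply hbij.1
  simp only
  rw [ConnectedComponent.eq]
  have e : ∀ u, G'.Reachable (G.connectedComponentMk u).out u := by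
    intro u
    apply reach_of_adj h
    rw [← ConnectedComponent.eq]
    exact Quot.out_eq _
  exact (e x).trans (h1.trans (e z).symm)

/-- the switch: remove `xy`, `zw`, add `xz`, `yw` -/
def sw (F : SimpleGraph V) (x y z w : V) : SimpleGraph V :=
  ad (ad (dl (dl F x y) z w) x z) y w

theorem sw_adj {F : SimpleGraph V} {x y z w : V} (h1 : x ≠ z) (h2 : y ≠ w) {a b : V} :
    (sw F x y z w).Adj a b ↔ (F.Adj a b ∧ ¬ ((a = x ∧ b = y) ∨ (a = y ∧ b = x)) ∧
      ¬ ((a = z ∧ b = w) ∨ (a = w ∧ b = z))) ∨ (a = x ∧ b = z) ∨ (a = z ∧ b = x) ∨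
      (a = y ∧ b = w) ∨ (a = w ∧ b = y) := by
  rw [sw, ad_adj h2, ad_adj h1, dl_adj, dl_adj]
  simp only [and_assoc, or_assoc]

theorem sw_dg {F : SimpleGraph V} {x y z w : V} (hxy : F.Adj x y) (hzw : F.Adj z w)
    (hxz : x ≠ z) (hyw : y ≠ w) (hxw : x ≠ w) (hyz : y ≠ z) (h1 : ¬ F.Adj x z) (h2 : ¬ F.Adj y w)
    (c : V) : dg (sw F x y z w) c = dg F c := by
  classical
  have e1 : (dl F x y).Adj z w := by rw [dl_adj]; grind
  have e2 : ¬ (dl (dl F x y) z w).Adj x z := by rw [dl_adj, dl_adj]; grind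
  have e3 : ¬ (ad (dl (dl F x y) z w) x z).Adj y w := by
    rw [ad_adj hxz, dl_adj, dl_adj]
    have := hxy.ne
    grind
  rw [sw, dg_ad hyw e3, dg_ad hxz e2, ← dg_dl hxy c, ← dg_dl e1 c]
  omega

theorem sw_Dj {T F : SimpleGraph V} {x y z w : V} (hxz : x ≠ z) (hyw : y ≠ w)
    (hd : Dj T F) (h1 : ¬ T.Adj x z) (h2 : ¬ T.Adj y w) : Dj T (sw F x y z w) := by
  intro a b hab
  rw [sw_adj hxz hyw] at hab
  rcases hab with hab | ⟨rfl, rfl⟩ | ⟨rfl, rfl⟩ | ⟨rfl, rfl⟩ | ⟨rfl, rfl⟩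
  · exact hd _ _ hab.1
  · exact h1
  · exact fun h => h1 h.symm
  · exact h2
  · exact fun h => h2 h.symm

/-- `F` is disjoint from `T` and has the least number of components among the graphs with the
same degrees -/
def Mn (T F : SimpleGraph V) : Prop := Dj T F ∧ ∀ F' : SimpleGraph V, Dj T F' →
  (∀ v, dg F' v = dg F v) → cc F ≤ cc F'

theorem Mn.of_le {T F F' : SimpleGraph V} (h : Mn T F) (hd : Dj T F')
    (hg : ∀ v, dg F' v = dg F v) (hc : cc F' ≤ cc F) : Mn T F' :=
  ⟨hd, fun F'' h1 h2 => hc.trans (h.2 F'' h1 fun v => (h2 v).trans (hg v))⟩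

/-- edges of components other than that of `x` may be deleted -/
theorem reach_dl_other {G : SimpleGraph V} {x y z w : V} (h : G.Reachable x y)
    (hz : ¬ G.Reachable x z) : (dl G z w).Reachable x y := by
  refine reach_of_adj_local (fun a b hxa hab => Adj.reachable ?_) h
  rw [dl_adj]
  refine ⟨hab, ?_⟩
  rintro (⟨rfl, rfl⟩ | ⟨rfl, rfl⟩)
  · exact hz hxa
  · exact hz (hxa.trans hab.reachable)

theorem cherry1 {T F : SimpleGraph V} (hF : Mn T F) {x y z w : V} (hxy : NB F x y)
    (hzw : F.Adj z w) (hxz : ¬ F.Reachable x z) : T.Adj x z ∨ T.Adj y w := by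
  by_contra hcon
  push Not at hcon
  obtain ⟨c1, c2⟩ := hcon
  have hxw : ¬ F.Reachable x w := fun h => hxz (h.trans hzw.symm.reachable)
  have hyz : ¬ F.Reachable y z := fun h => hxz (hxy.1.reachable.trans h)
  have hyw : ¬ F.Reachable y w := fun h => hxw (hxy.1.reachable.trans h)
  have n1 : x ≠ z := fun h => hxz (h ▸ Reachable.refl _)
  have n2 : x ≠ w := fun h => hxw (h ▸ Reachable.refl _)
  have n3 : y ≠ z := fun h => hyz (h ▸ Reachable.refl _)
  have n4 : y ≠ w := fun h => hyw (h ▸ Reachable.refl _)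
  have hd := sw_Dj n1 n4 hF.1 c1 c2
  have hg := sw_dg hxy.1 hzw n1 n4 n2 n3 (fun h => hxz h.reachable) (fun h => hyw h.reachable)
  have hle := hF.2 _ hd hg
  have s1 : (sw F x y z w).Adj x z := by rw [sw_adj n1 n4]; simp
  have s2 : (sw F x y z w).Adj y w := by rw [sw_adj n1 n4]; simp
  have s3 : (sw F x y z w).Reachable x y := by
    refine (reach_dl_other (w := w) hxy.2 (fun h => hxz (h.mono (dl_le _ _ _)))).mono ?_
    intro a b hab
    rw [dl_adj, dl_adj] at hab
    rw [sw_adj n1 n4]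
    exact Or.inl ⟨hab.1.1, hab.1.2, hab.2⟩
  have s4 : (sw F x y z w).Reachable z w :=
    s1.symm.reachable.trans (s3.trans s2.reachable)
  have := cc_lt (G := F) (G' := sw F x y z w) (fun a b hab => ?_) s1.reachable hxz
  · omega
  · by_cases e1 : (a = x ∧ b = y) ∨ (a = y ∧ b = x)
    · rcases e1 with ⟨rfl, rfl⟩ | ⟨rfl, rfl⟩
      · exact s3
      · exact s3.symm
    by_cases e2 : (a = z ∧ b = w) ∨ (a = w ∧ b = z)
    · rcases e2 with ⟨rfl, rfl⟩ | ⟨rfl, rfl⟩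
      · exact s4
      · exact s4.symm
    apply Adj.reachable
    rw [sw_adj n1 n4]
    exact Or.inl ⟨hab, e1, e2⟩

theorem cherry2 {T F : SimpleGraph V} (hF : Mn T F) {x y z w : V} (hxy : NB F x y)
    (hzw : F.Adj z w) (hxz : ¬ F.Reachable x z) : T.Adj x w ∨ T.Adj y z :=
  cherry1 hF hxy hzw.symm (fun h => hxz (h.trans hzw.symm.reachable))

theorem lemC_aux {T F : SimpleGraph V} (hT : T.IsAcyclic) (hF : Mn T F) {x y z p q : V}
    (hxy : NB F x y) (hxz : T.Adj x z) (hyz : T.Adj y z) (hpq : F.Adj p q)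
    (hxp : ¬ F.Reachable x p) (hpz : p ≠ z) (hqz : q ≠ z) (h1 : T.Adj x p) (h2 : T.Adj x q) :
    False := by
  obtain ⟨y2, hy2, hn⟩ := hxy.next
  have hyp : ¬ F.Reachable y p := fun h => hxp (hxy.1.reachable.trans h)
  have c1 := cherry1 hF hn hpq hyp
  have c2 := cherry2 hF hn hpq hyp
  have d1 : ¬ T.Adj y p := fun h => noC4 hT hxy.1.ne hpz h1 h hxz hyz
  have d2 : ¬ T.Adj y q := fun h => noC4 hT hxy.1.ne hqz h2 h hxz hyz
  have c1 := c1.resolve_left d1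
  have c2 := c2.resolve_left d2
  exact noC4 hT hy2 hpq.ne c2 h1 c1 h2

theorem lemC {T F : SimpleGraph V} (hT : T.IsAcyclic) (hF : Mn T F) {x y z p q : V}
    (hxy : NB F x y) (hxz : T.Adj x z) (hyz : T.Adj y z) (hpq : F.Adj p q)
    (hxp : ¬ F.Reachable x p) (hpz : p ≠ z) (hqz : q ≠ z) : False := by
  have c1 := cherry1 hF hxy hpq hxp
  have c2 := cherry2 hF hxy hpq hxp
  have hyp : ¬ F.Reachable y p := fun h => hxp (hxy.1.reachable.trans h)
  have d1 : ¬ (T.Adj x p ∧ T.Adj y p) := fun h => noC4 hT hxy.1.ne hpz h.1 h.2 hxz hyz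
  have d2 : ¬ (T.Adj x q ∧ T.Adj y q) := fun h => noC4 hT hxy.1.ne hqz h.1 h.2 hxz hyz
  by_cases h : T.Adj x p
  · exact lemC_aux hT hF hxy hxz hyz hpq hxp hpz hqz h (by tauto)
  · exact lemC_aux hT hF hxy.symm hyz hxz hpq hyp hpz hqz (by tauto) (by tauto)

/-- Step B -/
theorem stepB {T F : SimpleGraph V} (hT : T.IsAcyclic) (hF : Mn T F) {x y z w : V}
    (hxy : NB F x y) (hzw : F.Adj z w) (hxz : ¬ F.Reachable x z) :
    ∃ x y z w, NB F x y ∧ F.Adj z w ∧ ¬ F.Reachable x z ∧ T.Adj x z ∧ T.Adj y z := by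
  have hxw : ¬ F.Reachable x w := fun h => hxz (h.trans hzw.symm.reachable)
  have aux : ∀ x y, NB F x y → ¬ F.Reachable x z → T.Adj x z → T.Adj x w →
      ∃ x y z w, NB F x y ∧ F.Adj z w ∧ ¬ F.Reachable x z ∧ T.Adj x z ∧ T.Adj y z := by
    intro x y hxy hxz h1 h2
    have hyz : ¬ F.Reachable y z := fun h => hxz (hxy.1.reachable.trans h)
    have hyw : ¬ F.Reachable y w := fun h => hyz (h.trans hzw.symm.reachable)
    obtain ⟨y2, hy2, hn⟩ := hxy.next
    have c1 := cherry1 hF hn hzw hyz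
    have c2 := cherry2 hF hn hzw hyz
    have d1 : ¬ (T.Adj y z ∧ T.Adj y w) := fun h => noC4 hT hxy.1.ne hzw.ne h1 h.1 h2 h.2
    have d2 : ¬ (T.Adj y2 z ∧ T.Adj y2 w) := fun h => noC4 hT hy2 hzw.ne h.1 h1 h.2 h2
    by_cases h : T.Adj y z
    · exact ⟨y, y2, z, w, hn, hzw, hyz, h, by tauto⟩
    · exact ⟨y, y2, w, z, hn, hzw.symm, hyw, by tauto, by tauto⟩
  have c1 := cherry1 hF hxy hzw hxz
  have c2 := cherry2 hF hxy hzw hxz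
  have hyz : ¬ F.Reachable y z := fun h => hxz (hxy.1.reachable.trans h)
  by_cases h1 : T.Adj x z
  · by_cases h2 : T.Adj x w
    · exact aux x y hxy hxz h1 h2
    · exact ⟨x, y, z, w, hxy, hzw, hxz, h1, by tauto⟩
  · by_cases h2 : T.Adj x w
    · exact ⟨x, y, w, z, hxy, hzw.symm, hxw, h2, by tauto⟩
    · exact aux y x hxy.symm hyz (by tauto) (by tauto)

end ForestC

namespace ForestC

variable {V : Type*} [Fintype V]

theorem NB.path {F : SimpleGraph V} {x y : V} (h : NB F x y) :
    ∃ p : F.Walk x y, p.IsPath ∧ s(x, y) ∉ p.edges ∧ ∀ a b, s(a, b) ∈ p.edges → NB F a b := by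
  classical
  have h2 := h.2
  rw [dl, reachable_deleteEdges_iff_exists_walk] at h2
  obtain ⟨q, hq⟩ := h2
  have hq2 : s(x, y) ∉ (q.toPath : F.Walk x y).edges :=
    fun h => hq (Walk.edges_toPath_subset_edges q h)
  refine ⟨q.toPath, q.toPath.2, hq2, fun a b hab => ?_⟩
  have hc : (Walk.cons h.1.symm (q.toPath : F.Walk x y)).IsCycle := by
    apply Path.cons_isCycle
    rwa [Sym2.eq_swap]
  exact adj_and_reachable_delete_edges_iff_exists_cycle.2
    ⟨y, _, hc, by rw [Walk.edges_cons]; exact List.mem_cons_of_mem _ hab⟩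

theorem walk_m {T F : SimpleGraph V} {z w : V} {u y : V} (q : F.Walk u y)
    (hc : ∀ a b, s(a, b) ∈ q.edges → T.Adj a z ∨ T.Adj b w) (hy : T.Adj y z)
    (hu : ¬ T.Adj u z) : ∃ m ∈ q.support, T.Adj m z ∧ T.Adj m w := by
  induction q with
  | nil => exact absurd hy hu
  | @cons u v y h q ih =>
    have h1 : T.Adj v w := (hc u v (by simp)).resolve_left hu
    by_cases h2 : T.Adj v z
    · exact ⟨v, by simp, h2, h1⟩
    · obtain ⟨m, hm, h3⟩ := ih (fun a b hab => hc a b (by simp [hab])) hy h2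
      exact ⟨m, by simp [hm], h3⟩

theorem path_avoid {T F : SimpleGraph V} (hT : T.IsAcyclic) (hF : Mn T F) {x y z w v v' : V}
    (hxy : NB F x y) (hzw : F.Adj z w) (hxz : ¬ F.Reachable x z)
    (h1 : T.Adj x z) (h2 : T.Adj y z) (hv : ¬ T.Adj v z) :
    (dl (dl F x y) v v').Reachable x y := by
  classical
  obtain ⟨p, hp, hpe, hnb⟩ := hxy.path
  have hc : ∀ a b, s(a, b) ∈ p.edges → T.Adj a z ∨ T.Adj b w := by
    intro a b hab
    refine cherry1 hF (hnb a b hab) hzw fun h => hxz ?_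
    exact Reachable.trans ⟨p.takeUntil a (p.fst_mem_support_of_mem_edges hab)⟩ h
  have hvs : v ∉ p.support := by
    intro hvs
    obtain ⟨m1, hm1, hm1z, hm1w⟩ := walk_m (T := T) (z := z) (w := w) (p.takeUntil v hvs).reverse
      (fun a b hab => hc a b (p.edges_takeUntil_subset_edges hvs (by simpa using hab))) h1 hv
    obtain ⟨m2, hm2, hm2z, hm2w⟩ := walk_m (T := T) (z := z) (w := w) (p.dropUntil v hvs)
      (fun a b hab => hc a b (p.edges_dropUntil_subset_edges hvs hab)) h2 hv
    have hm : m1 = m2 := by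
      by_contra hne
      exact noC4 hT hne hzw.ne hm1z hm2z hm1w hm2w
    have hp2 : ((p.takeUntil v hvs).append (p.dropUntil v hvs)).IsPath := by
      rw [p.take_spec]; exact hp
    refine hp2.ne_of_mem_support_of_append (x := m1) (y := m2) ?_ (by simpa using hm1) hm2 hm
    rintro rfl
    exact hv hm2z
  refine ⟨p.transfer _ ?_⟩
  intro e he
  induction e with
  | _ a b =>
    rw [mem_edgeSet, dl_adj, dl_adj]
    refine ⟨⟨p.adj_of_mem_edges he, ?_⟩, ?_⟩
    · rintro (⟨rfl, rfl⟩ | ⟨rfl, rfl⟩)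
      · exact hpe he
      · rw [Sym2.eq_swap] at he; exact hpe he
    · rintro (⟨rfl, rfl⟩ | ⟨rfl, rfl⟩)
      · exact hvs (p.fst_mem_support_of_mem_edges he)
      · exact hvs (p.snd_mem_support_of_mem_edges he)

theorem E_core {T F : SimpleGraph V} (hT : T.IsAcyclic) (hF : Mn T F) {x y z w x' y' : V}
    (hxy : NB F x y) (hxy' : NB F x' y') (hzw : F.Adj z w) (hxz : ¬ F.Reachable x z)
    (hr : F.Reachable x x')
    (h1 : T.Adj x z) (h2 : T.Adj y z) (h3 : ¬ T.Adj x w) (h4 : ¬ T.Adj y w)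
    (h1' : T.Adj x' w) (h2' : T.Adj y' w) (h3' : ¬ T.Adj x' z) (h4' : ¬ T.Adj y' z)
    (e1 : ¬ T.Adj x x') (e2 : ¬ T.Adj y y') (f1 : ¬ F.Adj x x') (f2 : ¬ F.Adj y y') : False := by
  have n1 : x ≠ x' := fun h => h3' (h ▸ h1)
  have n2 : x ≠ y' := fun h => h4' (h ▸ h1)
  have n3 : y ≠ x' := fun h => h3' (h ▸ h2)
  have n4 : y ≠ y' := fun h => h4' (h ▸ h2)
  have hd := sw_Dj n1 n4 hF.1 e1 e2
  have hg := sw_dg hxy.1 hxy'.1 n1 n4 n2 n3 f1 f2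
  have hxw : ¬ F.Reachable x w := fun h => hxz (h.trans hzw.symm.reachable)
  have hx'w : ¬ F.Reachable x' w := fun h => hxw (hr.trans h)
  have p1 : (dl (dl F x y) x' y').Reachable x y := path_avoid hT hF hxy hzw hxz h1 h2 h3'
  have p2 : (dl (dl F x' y') x y).Reachable x' y' :=
    path_avoid hT hF hxy' hzw.symm hx'w h1' h2' h3
  set F' := sw F x y x' y' with hF'
  have s1 : F'.Adj x x' := by rw [hF', sw_adj n1 n4]; simp
  have s2 : F'.Adj y y' := by rw [hF', sw_adj n1 n4]; simp
  have le1 : dl (dl F x y) x' y' ≤ dl F' x x' := by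
    intro a b hab
    rw [dl_adj, dl_adj] at hab
    rw [dl_adj, hF', sw_adj n1 n4]
    refine ⟨Or.inl ⟨hab.1.1, hab.1.2, hab.2⟩, ?_⟩
    rintro (⟨rfl, rfl⟩ | ⟨rfl, rfl⟩)
    · exact f1 hab.1.1
    · exact f1 hab.1.1.symm
  have le2 : dl (dl F x' y') x y ≤ dl F' x x' := by
    refine le_trans ?_ le1
    intro a b hab
    rw [dl_adj, dl_adj] at hab ⊢
    exact ⟨⟨hab.1.1, hab.2⟩, hab.1.2⟩
  have q1 := p1.mono le1
  have q2 := p2.mono le2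
  have q3 : (dl F' x x').Adj y y' := by
    rw [dl_adj]
    refine ⟨s2, ?_⟩
    rintro (h | h)
    · exact hxy.1.ne h.1.symm
    · exact n3 h.1
  have hnb : NB F' x x' := ⟨s1, q1.trans (q3.reachable.trans q2.symm)⟩
  have hmono : ∀ a b, F.Adj a b → F'.Reachable a b := by
    intro a b hab
    by_cases e1 : (a = x ∧ b = y) ∨ (a = y ∧ b = x)
    · rcases e1 with ⟨rfl, rfl⟩ | ⟨rfl, rfl⟩
      · exact q1.mono (dl_le _ _ _)
      · exact (q1.mono (dl_le _ _ _)).symm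
    by_cases e2 : (a = x' ∧ b = y') ∨ (a = y' ∧ b = x')
    · rcases e2 with ⟨rfl, rfl⟩ | ⟨rfl, rfl⟩
      · exact q2.mono (dl_le _ _ _)
      · exact (q2.mono (dl_le _ _ _)).symm
    apply Adj.reachable
    rw [hF', sw_adj n1 n4]
    exact Or.inl ⟨hab, e1, e2⟩
  have hM : Mn T F' := hF.of_le hd hg (cc_le hmono)
  have hnr : ¬ F'.Reachable x z := by
    intro h
    have := cc_lt hmono h hxz
    have := hF.2 F' hd hg
    omega
  have hzw' : F'.Adj z w := by
    rw [hF', sw_adj n1 n4]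
    refine Or.inl ⟨hzw, ?_, ?_⟩
    · rintro (⟨rfl, rfl⟩ | ⟨rfl, rfl⟩)
      · exact hxz (Reachable.refl _)
      · exact hxw (Reachable.refl _)
    · rintro (⟨rfl, rfl⟩ | ⟨rfl, rfl⟩)
      · exact hxz hr
      · exact hxw hr
  rcases cherry2 hM hnb hzw' hnr with h | h
  · exact h3 h
  · exact h3' h

theorem lemE {T F : SimpleGraph V} (hT : T.IsAcyclic) (hF : Mn T F) {x y z w a b : V}
    (hxy : NB F x y) (hzw : F.Adj z w) (hxz : ¬ F.Reachable x z)
    (h1 : T.Adj x z) (h2 : T.Adj y z) (hab : NB F a b) (hxa : F.Reachable x a)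
    (haz : ¬ T.Adj a z) : False := by
  have hzwT : ¬ T.Adj z w := hF.1 _ _ hzw
  let cl : V → Prop := fun v => T.Adj v w ∨ ∃ t, T.Adj v t ∧ T.Adj t w
  have clr : ∀ v, T.Adj v z → cl v → (T.deleteIncidenceSet z).Reachable v w := by
    rintro v hv (h | ⟨t, h, h'⟩)
    · apply Adj.reachable
      rw [deleteIncidenceSet_adj]; exact ⟨h, hv.ne, hzw.ne.symm⟩
    · have htz : t ≠ z := by rintro rfl; exact hzwT h'
      have e1 : (T.deleteIncidenceSet z).Adj v t := by
        rw [deleteIncidenceSet_adj]; exact ⟨h, hv.ne, htz⟩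
      have e2 : (T.deleteIncidenceSet z).Adj t w := by
        rw [deleteIncidenceSet_adj]; exact ⟨h', htz, hzw.ne.symm⟩
      exact e1.reachable.trans e2.reachable
  have cl1 : ∀ u v, u ≠ v → T.Adj u z → T.Adj v z → cl u → ¬ cl v := by
    intro u v huv hu hv hcu hcv
    exact pfa hT hu.symm hv.symm huv ((clr u hu hcu).trans (clr v hv hcv).symm)
  have clw : ∀ v, ¬ cl v → ¬ T.Adj v w := fun v h h' => h (Or.inl h')
  have step1 : ∃ x y, NB F x y ∧ F.Reachable x a ∧ ¬ F.Reachable x z ∧ T.Adj x z ∧ T.Adj y z ∧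
      ¬ cl x ∧ ¬ cl y := by
    have aux : ∀ x y, NB F x y → F.Reachable x a → ¬ F.Reachable x z → T.Adj x z → T.Adj y z →
        cl x → ∃ x y, NB F x y ∧ F.Reachable x a ∧ ¬ F.Reachable x z ∧ T.Adj x z ∧ T.Adj y z ∧
      ¬ cl x ∧ ¬ cl y := by
      intro x y hxy hxa hxz h1 h2 hc
      obtain ⟨y2, hy2, hn⟩ := hxy.next
      have hyz : ¬ F.Reachable y z := fun h => hxz (hxy.1.reachable.trans h)
      have hcy := cl1 x y hxy.1.ne h1 h2 hc
      have c2 := (cherry2 hF hn hzw hyz).resolve_left (clw y hcy)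
      exact ⟨y, y2, hn, hxy.1.symm.reachable.trans hxa, hyz, h2, c2, hcy,
        cl1 x y2 hy2.symm h1 c2 hc⟩
    by_cases hx : cl x
    · exact aux x y hxy hxa hxz h1 h2 hx
    by_cases hy : cl y
    · exact aux y x hxy.symm (hxy.1.symm.reachable.trans hxa)
        (fun h => hxz (hxy.1.reachable.trans h)) h2 h1 hy
    exact ⟨x, y, hxy, hxa, hxz, h1, h2, hx, hy⟩
  have haz' : ¬ F.Reachable a z := fun h => hxz (hxa.trans h)
  have step2 : ∃ b, NB F a b ∧ T.Adj a w ∧ T.Adj b w ∧ ¬ T.Adj b z := by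
    have c1 := (cherry1 hF hab hzw haz').resolve_left haz
    have c2 := cherry2 hF hab hzw haz'
    by_cases hbz : T.Adj b z
    · obtain ⟨b2, hb2, hn⟩ := hab.symm.next
      have c3 := (cherry1 hF hn hzw haz').resolve_left haz
      have c4 := cherry2 hF hn hzw haz'
      have hb2z : ¬ T.Adj b2 z := fun h => noC4 hT hb2 hzw.ne h hbz c3 c1
      exact ⟨b2, hn, c4.resolve_right hb2z, c3, hb2z⟩
    · exact ⟨b, hab, c2.resolve_right hbz, c1, hbz⟩
  obtain ⟨x, y, hxy, hxa, hxz, h1, h2, hcx, hcy⟩ := step1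
  obtain ⟨b, hab, haw, hbw, hbz⟩ := step2
  have hyz : ¬ F.Reachable y z := fun h => hxz (hxy.1.reachable.trans h)
  have t1 : ¬ T.Adj x a := fun h => hcx (Or.inr ⟨a, h, haw⟩)
  have t2 : ¬ T.Adj x b := fun h => hcx (Or.inr ⟨b, h, hbw⟩)
  have t3 : ¬ T.Adj y a := fun h => hcy (Or.inr ⟨a, h, haw⟩)
  have t4 : ¬ T.Adj y b := fun h => hcy (Or.inr ⟨b, h, hbw⟩)
  have hxw := clw x hcx
  have hyw := clw y hcy
  have n1 : x ≠ a := fun h => haz (h ▸ h1)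
  have n2 : x ≠ b := fun h => hbz (h ▸ h1)
  have n3 : y ≠ a := fun h => haz (h ▸ h2)
  have n4 : y ≠ b := fun h => hbz (h ▸ h2)
  have tri : ∀ p q r, ¬ F.Reachable p z → ¬ T.Adj p w → ¬ T.Adj q z → F.Adj p q →
      F.Adj p r → F.Adj r q → False := by
    intro p q r hp hpw hqz hpq hpr hrq
    have hnb : NB F p q := by
      refine ⟨hpq, ?_⟩
      have e1 : (dl F p q).Adj p r := by
        rw [dl_adj]
        have := hrq.ne
        have := hpr.ne
        grind
      have e2 : (dl F p q).Adj r q := by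
        rw [dl_adj]
        have := hrq.ne
        have := hpr.ne
        grind
      exact e1.reachable.trans e2.reachable
    rcases cherry2 hF hnb hzw hp with h | h
    · exact hpw h
    · exact hqz h
  by_cases f : F.Adj x a ∨ F.Adj y b
  · have g1 : ¬ F.Adj x b := by
      intro g
      rcases f with f | f
      · exact tri x a b hxz hxw haz f g hab.1.symm
      · exact tri x b y hxz hxw hbz g hxy.1 f
    have g2 : ¬ F.Adj y a := by
      intro g
      rcases f with f | f
      · exact tri x a y hxz hxw haz f hxy.1 g
      · exact tri y b a hyz hyw hbz f g hab.1
    exact E_core hT hF hxy hab.symm hzw hxz (hxa.trans hab.1.reachable) h1 h2 hxw hyw hbw haw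
      hbz haz t2 t3 g1 g2
  · push Not at f
    exact E_core hT hF hxy hab hzw hxz hxa h1 h2 hxw hyw haw hbw haz hbz t1 t4 f.1 f.2

end ForestC

namespace ForestC

variable {V : Type*} [Fintype V]

theorem reach_split {G : SimpleGraph V} {a u : V} (b : V) (h : G.Reachable a u) :
    (dl G a b).Reachable a u ∨ (dl G a b).Reachable b u := by
  refine reach_induct (P := fun u => (dl G a b).Reachable a u ∨ (dl G a b).Reachable b u)
    (Or.inl (Reachable.refl _)) ?_ h
  intro c d _ hc hcd
  by_cases e : (c = a ∧ d = b) ∨ (c = b ∧ d = a)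
  · rcases e with ⟨_, rfl⟩ | ⟨_, rfl⟩
    · exact Or.inr (Reachable.refl _)
    · exact Or.inl (Reachable.refl _)
  · have hA : (dl G a b).Adj c d := dl_adj.2 ⟨hcd, e⟩
    exact hc.imp (fun h => h.trans hA.reachable) (fun h => h.trans hA.reachable)

/-- Step D -/
theorem stepD {T F : SimpleGraph V} (hT : T.IsAcyclic) (hF : Mn T F) {x y z w a b : V}
    (hxy : NB F x y) (hzw : F.Adj z w) (hxz : ¬ F.Reachable x z) (h1 : T.Adj x z)
    (h2 : T.Adj y z) (hab : F.Adj a b) (hnb : ¬ NB F a b) (hxa : F.Reachable x a)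
    (hax : (dl F a b).Reachable a x) (haz : ¬ T.Adj a z) : T.Adj b w := by
  classical
  by_contra hbw
  have hxb : F.Reachable x b := hxa.trans hab.reachable
  have hxw : ¬ F.Reachable x w := fun h => hxz (h.trans hzw.symm.reachable)
  have haz' : ¬ F.Reachable a z := fun h => hxz (hxa.trans h)
  have hbw' : ¬ F.Reachable b w := fun h => hxw (hxb.trans h)
  have n1 : a ≠ z := fun h => hxz (h ▸ hxa)
  have n2 : a ≠ w := fun h => hxw (h ▸ hxa)
  have n3 : b ≠ z := fun h => hxz (h ▸ hxb)
  have n4 : b ≠ w := fun h => hxw (h ▸ hxb)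
  have hd := sw_Dj n1 n4 hF.1 haz hbw
  have hg := sw_dg hab hzw n1 n4 n2 n3 (fun h => haz' h.reachable) (fun h => hbw' h.reachable)
  have hle := hF.2 _ hd hg
  have s1 : (sw F a b z w).Adj a z := by rw [sw_adj n1 n4]; simp
  have s2 : (sw F a b z w).Adj b w := by rw [sw_adj n1 n4]; simp
  have hmono : ∀ u v, F.Reachable x u → (dl F a b).Reachable u v →
      (sw F a b z w).Reachable u v := by
    intro u v hu huv
    refine (reach_dl_other (w := w) huv
      (fun h => hxz (hu.trans (h.mono (dl_le _ _ _))))).mono ?_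
    intro c d hcd
    rw [dl_adj, dl_adj] at hcd
    rw [sw_adj n1 n4]
    exact Or.inl ⟨hcd.1.1, hcd.1.2, hcd.2⟩
  have sax := hmono a x hxa hax
  by_cases hx'b : (sw F a b z w).Reachable x b
  · have s3 := sax.trans hx'b
    have s4 : (sw F a b z w).Reachable z w :=
      s1.symm.reachable.trans (s3.trans s2.reachable)
    have := cc_lt (G := F) (G' := sw F a b z w) (fun c d hcd => ?_)
      (sax.symm.trans s1.reachable) hxz
    · omega
    · by_cases e1 : (c = a ∧ d = b) ∨ (c = b ∧ d = a)
      · rcases e1 with ⟨rfl, rfl⟩ | ⟨rfl, rfl⟩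
        · exact s3
        · exact s3.symm
      by_cases e2 : (c = z ∧ d = w) ∨ (c = w ∧ d = z)
      · rcases e2 with ⟨rfl, rfl⟩ | ⟨rfl, rfl⟩
        · exact s4
        · exact s4.symm
      apply Adj.reachable
      rw [sw_adj n1 n4]
      exact Or.inl ⟨hcd, e1, e2⟩
  · have hC : ∀ u p, ¬ F.Reachable x u → u ≠ z → F.Adj u p → p = z := by
      intro u p hu huz hup
      by_contra hpz
      exact lemC hT hF hxy h1 h2 hup hu huz hpz
    have hcc : cc (sw F a b z w) ≤ cc F := by
      refine Nat.card_le_card_of_surjective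
        (fun c : F.ConnectedComponent =>
          if c = F.connectedComponentMk z then (sw F a b z w).connectedComponentMk w
          else if c = F.connectedComponentMk x then (sw F a b z w).connectedComponentMk x
          else (sw F a b z w).connectedComponentMk c.out) ?_
      have hzx : F.connectedComponentMk x ≠ F.connectedComponentMk z := by
        rw [Ne, ConnectedComponent.eq]; exact hxz
      have key : ∀ u, (sw F a b z w).Reachable x u ∨ (sw F a b z w).Reachable w u ∨
          (¬ F.Reachable x u ∧ ¬ F.Reachable z u ∧ ∀ p, ¬ F.Adj u p) := by
        intro u
        by_cases hu : F.Reachable x u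
        · rcases reach_split b (hxa.symm.trans hu) with h | h
          · exact Or.inl (sax.symm.trans (hmono _ _ hxa h))
          · exact Or.inr (Or.inl (s2.symm.reachable.trans (hmono _ _ hxb h)))
        · have hxz' := sax.symm.trans s1.reachable
          by_cases huz : u = z
          · subst huz; exact Or.inl hxz'
          by_cases huw : u = w
          · subst huw; exact Or.inr (Or.inl (Reachable.refl _))
          by_cases hadj : F.Adj u z
          · left
            refine hxz'.trans (Adj.reachable ?_)
            rw [sw_adj n1 n4]
            left
            refine ⟨hadj.symm, ?_, ?_⟩
            · rintro (h | h)
              · exact n1 h.1.symm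
              · exact n3 h.1.symm
            · rintro (h | h)
              · exact huw h.2
              · exact huz h.2
          · right; right
            have hiso : ∀ p, ¬ F.Adj u p := by
              intro p hp
              exact hadj ((hC u p hu huz hp) ▸ hp)
            refine ⟨hu, ?_, hiso⟩
            intro h
            obtain ⟨p, hp, _⟩ := reach_first h.symm huz
            exact hiso p hp
      intro c
      induction c using ConnectedComponent.ind with
      | _ u =>
        rcases key u with h | h | ⟨h, h', hiso⟩
        · refine ⟨F.connectedComponentMk x, ?_⟩
          simp only [if_neg hzx, if_true]
          rw [ConnectedComponent.eq]; exact h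
        · refine ⟨F.connectedComponentMk z, ?_⟩
          simp only [if_true]
          rw [ConnectedComponent.eq]; exact h
        · refine ⟨F.connectedComponentMk u, ?_⟩
          have e1 : F.connectedComponentMk u ≠ F.connectedComponentMk z := by
            rw [Ne, ConnectedComponent.eq]; exact fun h => h' h.symm
          have e2 : F.connectedComponentMk u ≠ F.connectedComponentMk x := by
            rw [Ne, ConnectedComponent.eq]; exact fun h3 => h h3.symm
          simp only [if_neg e1, if_neg e2]
          have e3 : F.Reachable u (F.connectedComponentMk u).out := by
            rw [← ConnectedComponent.eq]
            exact (Quot.out_eq _).symm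
          have e4 : (F.connectedComponentMk u).out = u := by
            by_contra hne
            obtain ⟨p, hp, _⟩ := reach_first e3 (Ne.symm hne)
            exact hiso p hp
          rw [e4]
    have hM := hF.of_le hd hg hcc
    have hne : ∀ c d, F.Reachable x c → NB F c d → (sw F a b z w).Adj c d := by
      intro c d hc hcd
      rw [sw_adj n1 n4]
      left
      refine ⟨hcd.1, ?_, ?_⟩
      · rintro (⟨rfl, rfl⟩ | ⟨rfl, rfl⟩)
        · exact hnb hcd
        · exact hnb hcd.symm
      · rintro (⟨rfl, rfl⟩ | ⟨rfl, rfl⟩)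
        · exact hxz hc
        · exact hxw hc
    have hNB : NB (sw F a b z w) x y := by
      refine ⟨hne x y (Reachable.refl _) hxy, ?_⟩
      obtain ⟨p, hp, hp1, hp2⟩ := hxy.path
      have hq : ∀ e ∈ p.edges, e ∈ (dl (sw F a b z w) x y).edgeSet := by
        intro e he
        induction e using Sym2.ind with
        | _ c d =>
          rw [mem_edgeSet, dl_adj]
          refine ⟨hne c d ?_ (hp2 c d he), ?_⟩
          · exact (p.takeUntil c (p.fst_mem_support_of_mem_edges he)).reachable
          · rintro (⟨rfl, rfl⟩ | ⟨rfl, rfl⟩)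
            · exact hp1 he
            · exact hp1 (Sym2.eq_swap ▸ he)
      exact (p.transfer _ hq).reachable
    exact lemC hT hM hNB h1 h2 s2 hx'b n3 hzw.ne.symm

end ForestC

namespace ForestC

variable {V : Type*} [Fintype V]

theorem final_count {T F : SimpleGraph V} (hT : T.IsAcyclic) (hF : Mn T F)
    (hdeg : ∀ v, 4 ≤ dg T v + dg F v) {x y z w : V}
    (hxy : NB F x y) (hzw : F.Adj z w) (hxz : ¬ F.Reachable x z)
    (h1 : T.Adj x z) (h2 : T.Adj y z) : False := by
  classical
  have hC : ∀ u p, ¬ F.Reachable x u → u ≠ z → F.Adj u p → p = z := by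
    intro u p hu huz hup
    by_contra hpz
    exact lemC hT hF hxy h1 h2 hup hu huz hpz
  have hxw : ¬ F.Reachable x w := fun h => hxz (h.trans hzw.symm.reachable)
  have hzwne : z ≠ w := hzw.ne
  have hsmall : ∀ u, ¬ F.Reachable x u → u ≠ z → dg F u ≤ 1 := by
    intro u hu huz
    rw [dg, ← Finset.card_singleton z]
    apply Finset.card_le_card
    intro p hp
    rw [Finset.mem_singleton]
    exact hC u p hu huz (mem_nb.1 hp)
  have hw3 : 3 ≤ dg T w := by
    have := hsmall w hxw hzwne.symm
    have := hdeg w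
    omega
  let R : V → Prop := fun v => (T.deleteIncidenceSet w).Reachable v z
  let S : Finset V := Finset.univ.filter (fun v => v ≠ w ∧ ¬ R v)
  have hS : ∀ v, v ∈ S ↔ v ≠ w ∧ ¬ R v := by intro v; simp [S]
  have hwS : w ∉ S := by rw [hS]; tauto
  have hstep : ∀ u v, T.Adj u v → u ≠ w → v ≠ w → R v → R u := by
    intro u v huv hu hv hR
    refine Reachable.trans (Adj.reachable ?_) hR
    rw [deleteIncidenceSet_adj]; exact ⟨huv, hu, hv⟩
  have hSz : ∀ a ∈ S, ¬ T.Adj a z := by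
    intro a ha haz
    rw [hS] at ha
    exact ha.2 (hstep a z haz ha.1 hzwne (Reachable.refl _))
  have hSne : ∀ a ∈ S, a ≠ z := by
    rintro a ha rfl
    rw [hS] at ha
    exact ha.2 (Reachable.refl _)
  have hSnb : ∀ a ∈ S, nb T a ⊆ insert w S := by
    intro a ha u hu
    rw [mem_nb] at hu
    rw [Finset.mem_insert, hS]
    rw [hS] at ha
    by_cases huw : u = w
    · exact Or.inl huw
    · exact Or.inr ⟨huw, fun h => ha.2 (hstep a u hu ha.1 huw h)⟩
  have ht : dg T w ≤ (nb T w ∩ S).card + 1 := by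
    have e1 : (nb T w \ S).card ≤ 1 := by
      rw [Finset.card_le_one]
      intro p hp q hq
      rw [Finset.mem_sdiff, mem_nb, hS] at hp hq
      by_contra hpq
      have rp : R p := by
        by_contra h; exact hp.2 ⟨hp.1.ne.symm, h⟩
      have rq : R q := by
        by_contra h; exact hq.2 ⟨hq.1.ne.symm, h⟩
      exact pfa hT hp.1 hq.1 hpq (rp.trans rq.symm)
    have e2 := Finset.card_inter_add_card_sdiff (nb T w) S
    rw [dg]; omega
  have hsum := acyclic_sum_on hT (insert w S) ⟨w, Finset.mem_insert_self _ _⟩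
  rw [Finset.sum_insert hwS, Finset.card_insert_of_notMem hwS] at hsum
  have e3 : (nb T w ∩ S).card ≤ (nb T w ∩ insert w S).card := by
    apply Finset.card_le_card
    exact Finset.inter_subset_inter_left (Finset.subset_insert _ _)
  have e4 : ∑ a ∈ S, (nb T a ∩ insert w S).card = ∑ a ∈ S, dg T a := by
    refine Finset.sum_congr rfl fun a ha => ?_
    rw [Finset.inter_eq_left.2 (hSnb a ha), dg]
  rw [e4] at hsum
  let ex : V → Finset V := fun a => (nb F a).filter (fun b => (dl F a b).Reachable a x)
  have hex : ∀ a b, b ∈ ex a ↔ F.Adj a b ∧ (dl F a b).Reachable a x := by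
    intro a b; simp [ex, mem_nb]
  have hexd : ∀ a ∈ S, dg F a ≤ 1 + (ex a).card := by
    intro a ha
    by_cases hr : F.Reachable x a
    · have hax : a ≠ x := by
        rintro rfl
        exact hSz _ ha h1
      obtain ⟨p, hp, hp2⟩ := reach_parent hr.symm hax
      have : nb F a ⊆ insert p (ex a) := by
        intro b hb
        rw [mem_nb] at hb
        rw [Finset.mem_insert, hex]
        by_cases hbp : b = p
        · exact Or.inl hbp
        · exact Or.inr ⟨hb, hp2 b hbp⟩
      have e5 := Finset.card_le_card this
      have e6 := Finset.card_insert_le p (ex a)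
      rw [dg]; omega
    · have := hsmall a hr (hSne a ha)
      omega
  have hnN : ∀ a ∈ S, ∀ b, b ∈ ex a → ¬ NB F a b := by
    intro a ha b hb hN
    rw [hex] at hb
    exact lemE hT hF hxy hzw hxz h1 h2 hN (hb.2.mono (dl_le _ _ _)).symm (hSz a ha)
  have hexw : ∀ a ∈ S, ex a ⊆ nb T w := by
    intro a ha b hb
    have hn := hnN a ha b hb
    rw [hex] at hb
    rw [mem_nb]
    exact (stepD hT hF hxy hzw hxz h1 h2 hb.1 hn (hb.2.mono (dl_le _ _ _)).symm hb.2
      (hSz a ha)).symm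
  have hpair : ∀ a ∈ S, ∀ b, b ∈ ex a → ¬ (dl F b a).Reachable b x := by
    intro a ha b hb h
    refine hnN a ha b hb ?_
    rw [hex] at hb
    rw [dl_comm'] at h
    exact ⟨hb.1, hb.2.trans h.symm⟩
  have hdisj : (S : Set V).PairwiseDisjoint ex := by
    intro a ha a' ha' hne
    rw [Function.onFun, Finset.disjoint_left]
    intro b hb hb'
    have ha := Finset.mem_coe.1 ha
    have ha' := Finset.mem_coe.1 ha'
    have q := hpair a ha b hb
    have q' := hpair a' ha' b hb'
    by_cases hbx : b = x
    · subst hbx; exact q (Reachable.refl _)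
    rw [hex] at hb
    have hr : F.Reachable b x := hb.1.symm.reachable.trans (hb.2.mono (dl_le _ _ _))
    obtain ⟨p, -, hp⟩ := reach_parent hr hbx
    have f1 : a = p := by by_contra h; exact q (hp a h)
    have f2 : a' = p := by by_contra h; exact q' (hp a' h)
    exact hne (f1.trans f2.symm)
  have e7 : ∑ a ∈ S, (ex a).card ≤ dg T w := by
    rw [← Finset.card_biUnion hdisj, dg]
    apply Finset.card_le_card
    rw [Finset.biUnion_subset]
    exact hexw
  have e8 : ∑ a ∈ S, 4 ≤ ∑ a ∈ S, (dg T a + (1 + (ex a).card)) :=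
    Finset.sum_le_sum fun a ha => (hdeg a).trans (Nat.add_le_add_left (hexd a ha) _)
  rw [Finset.sum_add_distrib, Finset.sum_add_distrib, Finset.sum_const, Finset.sum_const] at e8
  have e9 : (nb T w ∩ S).card ≤ S.card := Finset.card_le_card Finset.inter_subset_right
  simp only [smul_eq_mul] at e8
  omega

theorem not_both_acyclic {T F : SimpleGraph V} [Nonempty V] (hT : T.IsAcyclic)
    (hdeg : ∀ v, 4 ≤ dg T v + dg F v) : ¬ F.IsAcyclic := by
  intro hF
  have h1 := acyclic_sum hT
  have h2 := acyclic_sum hF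
  have h3 : ∑ v : V, 4 ≤ ∑ v : V, (dg T v + dg F v) := Finset.sum_le_sum fun v _ => hdeg v
  rw [Finset.sum_add_distrib, Finset.sum_const, smul_eq_mul, Finset.card_univ] at h3
  omega

theorem exists_Mn (T F0 : SimpleGraph V) (h : Dj T F0) :
    ∃ F, Mn T F ∧ ∀ v, dg F v = dg F0 v := by
  classical
  obtain ⟨F, hF, hmin⟩ := Set.exists_min_image
    {F : SimpleGraph V | Dj T F ∧ ∀ v, dg F v = dg F0 v} cc (Set.toFinite _)
    ⟨F0, h, fun _ => rfl⟩
  refine ⟨F, ⟨hF.1, fun F' h1 h2 => hmin F' ⟨h1, fun v => (h2 v).trans (hF.2 v)⟩⟩, hF.2⟩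

theorem conn_support {F : SimpleGraph V} (hne : F.support.Nonempty)
    (h : ∀ u v, u ∈ F.support → v ∈ F.support → F.Reachable u v) :
    (F.induce F.support).Connected := by
  rw [connected_iff]
  refine ⟨?_, hne.to_subtype⟩
  rintro ⟨u, hu⟩ ⟨v, hv⟩
  have key : ∀ v, F.Reachable u v → ∃ hv : v ∈ F.support,
      (F.induce F.support).Reachable ⟨u, hu⟩ ⟨v, hv⟩ := by
    intro v hr
    refine reach_induct (P := fun v => ∃ hv : v ∈ F.support,
      (F.induce F.support).Reachable ⟨u, hu⟩ ⟨v, hv⟩) ⟨hu, Reachable.refl _⟩ ?_ hr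
    rintro a b - ⟨ha, hra⟩ hab
    refine ⟨⟨a, hab.symm⟩, hra.trans (Adj.reachable ?_)⟩
    exact hab
  exact (key v (h u v hu hv)).2

theorem main (k : ℕ) (hk : 4 ≤ k) (T : SimpleGraph V) (hT : T.IsAcyclic)
    (hn : k + 1 ≤ Fintype.card V) :
    ∃ F : SimpleGraph V, Dj T F ∧ (∀ v, k ≤ dg T v + dg F v) ∧
      F.edgeSet.ncard = (∑ v, (k - dg T v) + 1) / 2 ∧ (F.induce F.support).Connected := by
  classical
  obtain ⟨F0, hd0, hk0, hc0⟩ := phase1 k T hT hn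
  obtain ⟨F, hF, hg⟩ := exists_Mn T F0 hd0
  have hkF : ∀ v, k ≤ dg T v + dg F v := fun v => by rw [hg]; exact hk0 v
  have h4 : ∀ v, 4 ≤ dg T v + dg F v := fun v => hk.trans (hkF v)
  have : Nonempty V := Fintype.card_pos_iff.1 (by omega)
  refine ⟨F, hF.1, hkF, ?_, ?_⟩
  · have e1 := sum_dg F
    have e2 := sum_dg F0
    have e3 : ∑ v, dg F v = ∑ v, dg F0 v := Finset.sum_congr rfl fun v _ => hg v
    rw [← hc0]
    omega
  · obtain ⟨x, y, hxy⟩ := exists_NB (not_both_acyclic hT h4)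
    have hx : ∀ z, z ∈ F.support → F.Reachable x z := by
      rintro z ⟨w, hzw⟩
      by_contra hxz
      obtain ⟨x', y', z', w', a1, a2, a3, a4, a5⟩ := stepB hT hF hxy hzw hxz
      exact final_count hT hF h4 a1 a2 a3 a4 a5
    exact conn_support ⟨x, y, hxy.1⟩ fun u v hu hv => (hx u hu).symm.trans (hx v hv)

end ForestC

end


/-- For every integer `k ≥ 4` and every forest `T` on at least `k+1` vertices, there exists a
set `F` of exactly `⌈df(T)/2⌉` edges on `V(T)`, disjoint from `E(T)`, such that `T + F` has
minimum degree at least `k` and, moreover, the graph formed by the edges of `F` on the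
vertices they cover is connected. -/
theorem forest_completion_exists_connected {V : Type*} [Fintype V]
    (k : ℕ) (hk : 4 ≤ k) (T : SimpleGraph V) (hT : T.IsAcyclic)
    (hn : k + 1 ≤ Fintype.card V) :
    ∃ F : Set (Sym2 V),
      F.ncard = ((∑ v : V, (k - (T.neighborSet v).ncard)) + 1) / 2 ∧
      (∀ e ∈ F, ¬ e.IsDiag) ∧
      Disjoint F T.edgeSet ∧
      (∀ v : V, k ≤ ((T ⊔ SimpleGraph.fromEdgeSet F).neighborSet v).ncard) ∧
      ((SimpleGraph.fromEdgeSet F).induce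
        (SimpleGraph.fromEdgeSet F).support).Connected := by
  obtain ⟨F, hd, hk', hc, hcon⟩ := ForestC.main k hk T hT hn
  refine ⟨F.edgeSet, ?_, ?_, ?_, ?_, ?_⟩
  · rw [hc]
    simp only [ForestC.dg_eq]
  · intro e he
    exact SimpleGraph.not_isDiag_of_mem_edgeSet F he
  · rw [Set.disjoint_left]
    intro e
    induction e using Sym2.ind with
    | _ u v => exact fun h => hd u v h
  · intro v
    rw [SimpleGraph.fromEdgeSet_edgeSet]
    have e : (T ⊔ F).neighborSet v = T.neighborSet v ∪ F.neighborSet v := by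
      ext u; simp
    have hdis : Disjoint (T.neighborSet v) (F.neighborSet v) := by
      rw [Set.disjoint_left]
      intro u hu hu'
      exact hd v u hu' hu
    rw [e, Set.ncard_union_eq hdis (Set.toFinite _) (Set.toFinite _), ForestC.dg_eq, ForestC.dg_eq]
    exact hk' v
  · rw [SimpleGraph.fromEdgeSet_edgeSet]
    exact hcon
end

section
/- (Henning–Yeo) For every odd integer t ≥ 3, every connected graph G with n vertices, m edges, and maximum degree at most t contains a matching of size at least ((t−1)/(t(t²−3)))·n + ((t²−t−2)/(t(t²−3)))·m − (t−1)/(t(t²−3)). -/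
lemma hy_arith (t q e : ℕ) (htodd : Odd t) (ht : 3 ≤ t) (hq : 1 ≤ q)
    (h1 : 2 * e ≤ q * (q - 1)) (h2 : 2 * e ≤ t * q) :
    ((t : ℤ) - 1) * ((q : ℤ) - 1) + ((t : ℤ) ^ 2 - t - 2) * e
      ≤ (t : ℤ) * ((t : ℤ) ^ 2 - 3) * ((q / 2 : ℕ) : ℤ) := by
  obtain ⟨k, rfl⟩ := htodd
  rcases Nat.even_or_odd' q with ⟨a, rfl | rfl⟩
  · have e1 : 2 * a / 2 = a := by omega
    rw [e1]
    have h3 : e ≤ (2 * k + 1) * a := by nlinarith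
    have h3' : (e : ℤ) ≤ (2 * k + 1) * a := by exact_mod_cast h3
    have hk : (1 : ℤ) ≤ k := by omega
    have ha : (1 : ℤ) ≤ a := by omega
    push_cast
    have hc : (0 : ℤ) ≤ (2 * k + 1) ^ 2 - (2 * k + 1) - 2 := by nlinarith
    have := mul_le_mul_of_nonneg_left h3' hc
    nlinarith [mul_nonneg (sub_nonneg.2 hk) (sub_nonneg.2 ha),
      mul_nonneg (mul_nonneg (sub_nonneg.2 hk) (sub_nonneg.2 ha)) (sub_nonneg.2 hk)]
  · have e1 : (2 * a + 1) / 2 = a := by omega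
    rw [e1]
    have hk : (1 : ℤ) ≤ k := by omega
    have hc : (0 : ℤ) ≤ (2 * k + 1) ^ 2 - (2 * k + 1) - 2 := by nlinarith
    have ha : (0 : ℤ) ≤ a := by omega
    rcases le_or_gt a k with hak | hak
    · have h3 : e ≤ (2 * a + 1) * a := by
        simp only [Nat.add_sub_cancel] at h1
        nlinarith
      have h3' : (e : ℤ) ≤ (2 * a + 1) * a := by exact_mod_cast h3
      have := mul_le_mul_of_nonneg_left h3' hc
      have hak' : (a : ℤ) ≤ k := by exact_mod_cast hak
      push_cast
      have key : (0 : ℤ) ≤ (2 * k + 1) * ((2 * k + 1) ^ 2 - 3)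
          - ((2 * k + 1) ^ 2 - (2 * k + 1) - 2) * (2 * a + 1) - 2 * (2 * k) := by
        have := mul_le_mul_of_nonneg_left hak' hc
        nlinarith
      nlinarith [mul_nonneg ha key]
    · have h3 : 2 * e + 1 ≤ (2 * k + 1) * (2 * a + 1) := by
        have : (2 * k + 1) * (2 * a + 1) = 2 * (2 * k * a + k + a) + 1 := by ring
        omega
      have h3' : (2 * e + 1 : ℤ) ≤ (2 * k + 1) * (2 * a + 1) := by exact_mod_cast h3
      have := mul_le_mul_of_nonneg_left h3' hc
      have hak' : (k + 1 : ℤ) ≤ a := by exact_mod_cast hak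
      push_cast
      have hk2 : (0 : ℤ) ≤ (2 * k + 1) ^ 2 - 3 * (2 * k + 1) + 2 := by nlinarith
      nlinarith [mul_nonneg hk2 (sub_nonneg.2 hak')]

lemma hy_matching_card {V : Type*} [Fintype V] {G : SimpleGraph V} {M : G.Subgraph}
    (hM : M.IsMatching) : M.verts.ncard = 2 * M.edgeSet.ncard := by
  classical
  have h := M.spanningCoe.sum_degrees_eq_twice_card_edges
  have h1 : M.spanningCoe.edgeFinset.card = M.edgeSet.ncard := by
    rw [← Set.ncard_coe_finset, SimpleGraph.coe_edgeFinset, SimpleGraph.Subgraph.edgeSet_spanningCoe]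
  rw [h1] at h
  rw [← h, Set.ncard_eq_toFinset_card' M.verts, Finset.card_eq_sum_ones]
  have : ∀ v, M.spanningCoe.degree v = if v ∈ M.verts then 1 else 0 := by
    intro v
    rw [SimpleGraph.Subgraph.degree_spanningCoe]
    split_ifs with hv
    · exact (SimpleGraph.Subgraph.isMatching_iff_forall_degree.1 hM) v hv
    · exact SimpleGraph.Subgraph.degree_of_notMem_verts hv
  simp only [this, Finset.sum_boole]
  simp

/-- `G` with the edges meeting `S` removed. -/
def hyDel {V : Type*} (G : SimpleGraph V) (S : Set V) : SimpleGraph V where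
  Adj u v := G.Adj u v ∧ u ∉ S ∧ v ∉ S
  symm := ⟨fun _ _ h => ⟨h.1.symm, h.2.2, h.2.1⟩⟩
  loopless := ⟨fun _ h => h.1.ne rfl⟩

/-- component graph count: `K ≤ E + 1`. -/
lemma hy_conn {V : Type*} [Fintype V] {G H : SimpleGraph V} (hc : G.Connected) :
    Nat.card H.ConnectedComponent ≤ (G.edgeSet \ H.edgeSet).ncard + 1 := by
  classical
  let Q : SimpleGraph H.ConnectedComponent :=
    { Adj := fun a b => a ≠ b ∧ ∃ u v, G.Adj u v ∧ H.connectedComponentMk u = a ∧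
        H.connectedComponentMk v = b
      symm := ⟨by
        rintro a b ⟨h, u, v, h1, h2, h3⟩
        exact ⟨h.symm, v, u, h1.symm, h3, h2⟩⟩
      loopless := ⟨fun a h => h.1 rfl⟩ }
  have hreach : ∀ u v, G.Reachable u v →
      Q.Reachable (H.connectedComponentMk u) (H.connectedComponentMk v) := by
    rintro u v ⟨p⟩
    induction p with
    | nil => exact SimpleGraph.Reachable.refl _
    | @cons a b c h p ih =>
      by_cases hab : H.connectedComponentMk a = H.connectedComponentMk b
      · rw [hab]; exact ih
      · have : Q.Adj (H.connectedComponentMk a) (H.connectedComponentMk b) :=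
          ⟨hab, a, b, h, rfl, rfl⟩
        exact this.reachable.trans ih
  have hQ : Q.Connected := by
    obtain ⟨v⟩ := hc.nonempty
    have : Nonempty H.ConnectedComponent := ⟨H.connectedComponentMk v⟩
    refine ⟨fun a b => ?_⟩
    induction a using SimpleGraph.ConnectedComponent.ind
    induction b using SimpleGraph.ConnectedComponent.ind
    exact hreach _ _ (hc.preconnected _ _)
  have h1 := hQ.card_vert_le_card_edgeSet_add_one
  have h2 : Q.edgeSet ⊆ (Sym2.map H.connectedComponentMk) '' (G.edgeSet \ H.edgeSet) := by
    intro x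
    induction x with
    | h a b =>
      rintro ⟨hab, u, v, huv, rfl, rfl⟩
      refine ⟨s(u, v), ⟨huv, fun hh => hab ?_⟩, rfl⟩
      exact SimpleGraph.ConnectedComponent.sound (SimpleGraph.Adj.reachable hh)
  have h3 := Set.ncard_le_ncard h2 (Set.toFinite _)
  have h4 := Set.ncard_image_le (f := Sym2.map H.connectedComponentMk) (Set.toFinite (G.edgeSet \ H.edgeSet))
  rw [Nat.card_coe_set_eq] at h1
  omega

/-- edges meeting `S`. -/
lemma hy_edges_S {V : Type*} [Fintype V] (G : SimpleGraph V) (S : Set V) (t : ℕ)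
    (hdeg : ∀ v : V, (G.neighborSet v).ncard ≤ t) :
    (G.edgeSet \ (hyDel G S).edgeSet).ncard ≤ t * S.ncard := by
  classical
  have hsub : G.edgeSet \ (hyDel G S).edgeSet ⊆
      ((S.toFinset.biUnion fun v => (G.neighborSet v).toFinset.image fun w => s(v, w) :
        Finset (Sym2 V)) : Set (Sym2 V)) := by
    intro x
    induction x with
    | h a b =>
      rintro ⟨h1, h2⟩
      have h1' : G.Adj a b := h1
      have h2' : ¬ (G.Adj a b ∧ a ∉ S ∧ b ∉ S) := h2
      simp only [Finset.coe_biUnion, Set.mem_iUnion, Finset.coe_image, Set.mem_image]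
      by_cases ha : a ∈ S
      · exact ⟨a, by simpa using ha, b, by simpa using h1', rfl⟩
      · have hb : b ∈ S := by tauto
        exact ⟨b, by simpa using hb, a, by simpa using h1'.symm, Sym2.eq_swap⟩
  have h := Set.ncard_le_ncard hsub (Set.toFinite _)
  rw [Set.ncard_coe_finset] at h
  refine h.trans ?_
  have := Finset.card_biUnion_le_card_mul S.toFinset
    (fun v => (G.neighborSet v).toFinset.image fun w => s(v, w)) t (by
      intro v _
      refine Finset.card_image_le.trans ?_
      rw [← Set.ncard_eq_toFinset_card']
      exact hdeg v)
  rw [Set.ncard_eq_toFinset_card' S, mul_comm]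
  exact this

lemma hy_comp {V : Type*} [Fintype V] (H : SimpleGraph V) (t : ℕ) (htodd : Odd t) (ht : 3 ≤ t)
    (hdeg : ∀ v : V, (H.neighborSet v).ncard ≤ t) :
    ∃ F : ℕ, Fintype.card V = 2 * F + H.oddComponents.ncard ∧
     ((t : ℤ) - 1) * ((Fintype.card V : ℤ) - Nat.card H.ConnectedComponent)
        + ((t : ℤ) ^ 2 - t - 2) * H.edgeSet.ncard
      ≤ (t : ℤ) * ((t : ℤ) ^ 2 - 3) * F := by
  classical
  let f := H.connectedComponentMk
  let q : H.ConnectedComponent → ℕ := fun c => (Finset.univ.filter fun v => f v = c).card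
  have hq : ∀ c, c.supp.ncard = q c := by
    intro c
    rw [Set.ncard_eq_toFinset_card']
    congr 1
    ext v
    simp [f]
  have hn : Fintype.card V = ∑ c, q c :=
    Finset.card_eq_sum_card_fiberwise (s := Finset.univ) (t := Finset.univ) (f := f) (by simp)
  have hodd : H.oddComponents.ncard = ∑ c, q c % 2 := by
    rw [Set.ncard_eq_toFinset_card', Finset.card_eq_sum_ones]
    have : ∀ c, q c % 2 = if Odd c.supp.ncard then 1 else 0 := by
      intro c
      rw [hq]
      split_ifs with h
      · exact Nat.odd_iff.1 h
      · exact Nat.not_odd_iff.1 h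
    simp only [this, Finset.sum_boole]
    simp [SimpleGraph.oddComponents]
  have hD : 2 * H.edgeSet.ncard = ∑ c, ∑ v with f v = c, H.degree v := by
    have h1 := H.sum_degrees_eq_twice_card_edges
    rw [← Set.ncard_coe_finset, SimpleGraph.coe_edgeFinset] at h1
    rw [← h1]
    convert (Finset.sum_fiberwise Finset.univ f (fun v => H.degree v)).symm
  have hex : ∀ c, ∃ e, ∑ v with f v = c, H.degree v = 2 * e := by
    intro c
    let Hc : SimpleGraph V :=
      { Adj := fun u v => H.Adj u v ∧ f u = c ∧ f v = c
        symm := ⟨fun _ _ h => ⟨h.1.symm, h.2.2, h.2.1⟩⟩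
        loopless := ⟨fun _ h => h.1.ne rfl⟩ }
    refine ⟨Hc.edgeFinset.card, ?_⟩
    rw [← Hc.sum_degrees_eq_twice_card_edges, Finset.sum_filter]
    refine Finset.sum_congr rfl fun v _ => ?_
    split_ifs with hv
    · rw [← SimpleGraph.card_neighborFinset_eq_degree, ← SimpleGraph.card_neighborFinset_eq_degree]
      congr 1
      ext w
      simp only [SimpleGraph.mem_neighborFinset]
      refine ⟨fun h => ⟨h, hv, ?_⟩, fun h => h.1⟩
      rw [← hv]
      exact SimpleGraph.ConnectedComponent.sound h.reachable.symm
    · symm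
      rw [← SimpleGraph.card_neighborFinset_eq_degree, Finset.card_eq_zero,
        Finset.eq_empty_iff_forall_notMem]
      intro w hw
      rw [SimpleGraph.mem_neighborFinset] at hw
      exact hv hw.2.1
  choose e he using hex
  have hm : H.edgeSet.ncard = ∑ c, e c := by
    simp only [he, ← Finset.mul_sum] at hD
    omega
  have hq1 : ∀ c, 1 ≤ q c := by
    intro c
    induction c using SimpleGraph.ConnectedComponent.ind with
    | h v => exact Finset.card_pos.2 ⟨v, by simp [f]⟩
  have hb : ∀ c, ((t : ℤ) - 1) * ((q c : ℤ) - 1) + ((t : ℤ) ^ 2 - t - 2) * e c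
      ≤ (t : ℤ) * ((t : ℤ) ^ 2 - 3) * ((q c / 2 : ℕ) : ℤ) := by
    intro c
    refine hy_arith t (q c) (e c) htodd ht (hq1 c) ?_ ?_
    · rw [← he, ← smul_eq_mul]
      refine Finset.sum_le_card_nsmul _ _ _ fun v hv => ?_
      rw [← SimpleGraph.card_neighborFinset_eq_degree]
      have : H.neighborFinset v ⊆ (Finset.univ.filter fun v => f v = c).erase v := by
        intro w hw
        rw [SimpleGraph.mem_neighborFinset] at hw
        simp only [Finset.mem_filter, Finset.mem_univ, true_and] at hv
        simp only [Finset.mem_erase, Finset.mem_filter, Finset.mem_univ, true_and]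
        refine ⟨hw.ne', ?_⟩
        rw [← hv]
        exact SimpleGraph.ConnectedComponent.sound hw.reachable.symm
      have h2 := Finset.card_le_card this
      rwa [Finset.card_erase_of_mem hv] at h2
    · rw [← he, mul_comm, ← smul_eq_mul]
      refine Finset.sum_le_card_nsmul _ _ _ fun v hv => ?_
      have := hdeg v
      rwa [Set.ncard_eq_toFinset_card', ← SimpleGraph.neighborFinset_def,
        SimpleGraph.card_neighborFinset_eq_degree] at this
  refine ⟨∑ c, q c / 2, ?_, ?_⟩
  · rw [hn, hodd, Finset.mul_sum, ← Finset.sum_add_distrib]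
    exact Finset.sum_congr rfl fun c _ => (Nat.div_add_mod _ _).symm
  · have := Finset.sum_le_sum fun c (_ : c ∈ Finset.univ) => hb c
    rw [Finset.sum_add_distrib, ← Finset.mul_sum, ← Finset.mul_sum, ← Finset.mul_sum,
      Finset.sum_sub_distrib] at this
    rw [hn, hm, Nat.card_eq_fintype_card]
    push_cast
    push_cast at this
    simpa using this

/-- `G` together with `d` universal vertices. -/
def hyJoin {V : Type*} (G : SimpleGraph V) (d : ℕ) : SimpleGraph (V ⊕ Fin d) where
  Adj x y := x ≠ y ∧ ∀ u v, x = Sum.inl u → y = Sum.inl v → G.Adj u v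
  symm := ⟨fun _ _ h => ⟨h.1.symm, fun u v h1 h2 => (h.2 v u h2 h1).symm⟩⟩
  loopless := ⟨fun _ h => h.1 rfl⟩

lemma hyJoin_inl {V : Type*} (G : SimpleGraph V) (d : ℕ) (u v : V) :
    (hyJoin G d).Adj (Sum.inl u) (Sum.inl v) ↔ G.Adj u v := by
  refine ⟨fun h => h.2 u v rfl rfl, fun h => ⟨fun hh => h.ne (Sum.inl.inj hh), ?_⟩⟩
  rintro a b h1 h2
  cases h1; cases h2; exact h

/-- A perfect matching of the join gives a large matching of `G`. -/
lemma hy_restrict {V : Type*} [Fintype V] (G : SimpleGraph V) (d : ℕ)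
    (P : (hyJoin G d).Subgraph) (hP : P.IsPerfectMatching) :
    ∃ M : G.Subgraph, M.IsMatching ∧ Fintype.card V ≤ M.verts.ncard + d := by
  classical
  let M : G.Subgraph :=
    { verts := {v | ∃ w, P.Adj (Sum.inl v) (Sum.inl w)}
      Adj := fun v w => P.Adj (Sum.inl v) (Sum.inl w)
      adj_sub := fun h => (hyJoin_inl G d _ _).1 (P.adj_sub h)
      edge_vert := fun h => ⟨_, h⟩
      symm := ⟨fun _ _ h => SimpleGraph.Subgraph.Adj.symm h⟩ }
  rw [SimpleGraph.Subgraph.isPerfectMatching_iff] at hP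
  refine ⟨M, ?_, ?_⟩
  · rintro v ⟨w, hw⟩
    refine ⟨w, hw, fun y hy => ?_⟩
    exact Sum.inl.inj ((hP (Sum.inl v)).unique hy hw)
  · have hex : ∀ v : (M.vertsᶜ : Set V), ∃ i : Fin d, P.Adj (Sum.inl v.1) (Sum.inr i) := by
      rintro ⟨v, hv⟩
      obtain ⟨x, hx, -⟩ := hP (Sum.inl v)
      rcases x with w | i
      · exact absurd ⟨w, hx⟩ hv
      · exact ⟨i, hx⟩
    choose g hg using hex
    have hinj : Function.Injective g := by
      intro a b hab
      have h1 := hg a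
      rw [hab] at h1
      have := (hP (Sum.inr (g b))).unique h1.symm (hg b).symm
      exact Subtype.ext (Sum.inl.inj this)
    have h1 := Nat.card_le_card_of_injective g hinj
    rw [Nat.card_coe_set_eq, Nat.card_eq_fintype_card, Fintype.card_fin] at h1
    have h2 := Set.ncard_add_ncard_compl M.verts
    rw [Nat.card_eq_fintype_card] at h2
    omega

/-- Odd components under an embedding onto the complement of a set of isolated vertices. -/
lemma hy_embed {V X : Type*} [Fintype V] [Finite X] (A : SimpleGraph X) (H : SimpleGraph V)
    (S : Set V) (g : A ↪g H) (hr : Set.range g = Sᶜ) (hS : ∀ u v, H.Adj u v → u ∉ S) :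
    A.oddComponents.ncard + S.ncard ≤ H.oddComponents.ncard := by
  classical
  have hreach : ∀ v w, H.Reachable v w → ∀ x, g x = v → ∃ y, g y = w ∧ A.Reachable x y := by
    rintro v w ⟨p⟩
    induction p with
    | nil => exact fun x hx => ⟨x, hx, SimpleGraph.Reachable.refl _⟩
    | @cons a b c h p ih =>
      intro x hx
      have hb : b ∈ Set.range g := by rw [hr]; exact hS b a h.symm
      obtain ⟨z, hz⟩ := hb
      obtain ⟨y, hy, hzy⟩ := ih z hz
      refine ⟨y, hy, SimpleGraph.Reachable.trans (SimpleGraph.Adj.reachable ?_) hzy⟩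
      rw [← hx, ← hz] at h
      exact g.map_adj_iff.1 h
  have hiso : ∀ s ∈ S, ∀ w, H.Reachable s w → w = s := by
    rintro s hs w ⟨p⟩
    cases p with
    | nil => rfl
    | cons h p => exact absurd hs (hS _ _ h)
  let φ : A.ConnectedComponent → H.ConnectedComponent := fun c => c.map g.toHom
  have hsupp : ∀ c, (φ c).supp = g '' c.supp := by
    intro c
    induction c using SimpleGraph.ConnectedComponent.ind with
    | h x =>
      ext w
      simp only [φ, SimpleGraph.ConnectedComponent.map_mk, SimpleGraph.ConnectedComponent.mem_supp_iff,
        SimpleGraph.ConnectedComponent.eq, Set.mem_image]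
      constructor
      · intro h
        obtain ⟨y, hy, hxy⟩ := hreach _ _ h.symm x rfl
        exact ⟨y, hxy.symm, hy⟩
      · rintro ⟨y, hy, rfl⟩
        exact hy.map g.toHom
  have hφ : Function.Injective φ := by
    intro a b hab
    have h1 := hsupp a
    rw [hab, hsupp b] at h1
    exact SimpleGraph.ConnectedComponent.supp_injective
      ((Set.image_injective.2 g.injective) h1.symm)
  have hmkinj : Set.InjOn H.connectedComponentMk S := by
    intro a ha b hb hab
    exact (hiso a ha b (SimpleGraph.ConnectedComponent.exact hab)).symm
  have hsub : φ '' A.oddComponents ∪ H.connectedComponentMk '' S ⊆ H.oddComponents := by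
    rintro c (⟨a, ha, rfl⟩ | ⟨s, hs, rfl⟩)
    · show Odd (φ a).supp.ncard
      rw [hsupp, Set.ncard_image_of_injective _ g.injective]
      exact ha
    · show Odd (H.connectedComponentMk s).supp.ncard
      have : (H.connectedComponentMk s).supp = {s} := by
        ext w
        simp only [SimpleGraph.ConnectedComponent.mem_supp_iff, SimpleGraph.ConnectedComponent.eq,
          Set.mem_singleton_iff]
        exact ⟨fun h => hiso s hs w h.symm, fun h => h ▸ SimpleGraph.Reachable.refl _⟩
      rw [this, Set.ncard_singleton]
      exact odd_one
  have hdis : Disjoint (φ '' A.oddComponents) (H.connectedComponentMk '' S) := by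
    rw [Set.disjoint_left]
    rintro c ⟨a, ha, rfl⟩ ⟨s, hs, h⟩
    have : s ∈ (φ a).supp := h
    rw [hsupp] at this
    obtain ⟨x, -, hx⟩ := this
    have : s ∈ Set.range g := ⟨x, hx⟩
    rw [hr] at this
    exact this hs
  have h := Set.ncard_le_ncard hsub (Set.toFinite _)
  rwa [Set.ncard_union_eq hdis (Set.toFinite _) (Set.toFinite _),
    Set.ncard_image_of_injective _ hφ, Set.ncard_image_of_injOn hmkinj] at h

/-- Weak form of the Tutte–Berge formula. -/
lemma hy_violator {V : Type*} [Fintype V] (G : SimpleGraph V) (d : ℕ)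
    (hpar : Even (Fintype.card V + d)) (u : Set (V ⊕ Fin d))
    (hu : (hyJoin G d).IsTutteViolator u) :
    ∃ S : Set V, d + 1 + 2 * S.ncard ≤ (hyDel G S).oddComponents.ncard := by
  classical
  unfold SimpleGraph.IsTutteViolator at hu
  set A := ((⊤ : (hyJoin G d).Subgraph).deleteVerts u).coe with hA
  have hAadj : ∀ x y, A.Adj x y ↔ (hyJoin G d).Adj x.1 y.1 := by
    intro x y
    have hx := x.2
    have hy := y.2
    simp only [SimpleGraph.Subgraph.deleteVerts_verts, SimpleGraph.Subgraph.verts_top, Set.mem_diff,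
      Set.mem_univ, true_and] at hx hy
    simp [hA, SimpleGraph.Subgraph.deleteVerts_adj, hx, hy]
  have hmem : ∀ x : V ⊕ Fin d, x ∉ u → x ∈ ((⊤ : (hyJoin G d).Subgraph).deleteVerts u).verts := by
    intro x hx
    simpa using hx
  by_cases hall : ∀ i, Sum.inr i ∈ u
  · refine ⟨Sum.inl ⁻¹' u, ?_⟩
    have hinl : ∀ x : ((⊤ : (hyJoin G d).Subgraph).deleteVerts u).verts, ∃ v, Sum.inl v = x.1 := by
      rintro ⟨x, hx⟩
      rcases x with v | i
      · exact ⟨v, rfl⟩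
      · simp [hall i] at hx
    choose g hg using hinl
    have hgu : ∀ x, g x ∉ Sum.inl ⁻¹' u := by
      intro x hx
      have h1 : Sum.inl (g x) ∈ u := hx
      rw [hg x] at h1
      have h2 := x.2
      simp [h1] at h2
    let emb : A ↪g hyDel G (Sum.inl ⁻¹' u) :=
      { toFun := g
        inj' := by
          intro a b hab
          apply Subtype.ext
          rw [← hg a, ← hg b, hab]
        map_rel_iff' := by
          intro a b
          rw [hAadj, ← hg a, ← hg b, hyJoin_inl]
          exact ⟨fun h => h.1, fun h => ⟨h, hgu a, hgu b⟩⟩ }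
    have hr : Set.range emb = (Sum.inl ⁻¹' u)ᶜ := by
      ext v
      constructor
      · rintro ⟨x, rfl⟩
        exact hgu x
      · intro hv
        refine ⟨⟨Sum.inl v, hmem _ hv⟩, ?_⟩
        exact Sum.inl.inj (hg ⟨Sum.inl v, hmem _ hv⟩)
    have h1 := hy_embed A (hyDel G (Sum.inl ⁻¹' u)) (Sum.inl ⁻¹' u) emb hr (fun a b h => h.2.1)
    have h2 : d + (Sum.inl ⁻¹' u : Set V).ncard ≤ u.ncard := by
      have hsub : (Sum.inr '' (Set.univ : Set (Fin d)) ∪ Sum.inl '' (Sum.inl ⁻¹' u : Set V)) ⊆ u := by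
        rintro x (⟨i, -, rfl⟩ | ⟨v, hv, rfl⟩)
        · exact hall i
        · exact hv
      have h := Set.ncard_le_ncard hsub (Set.toFinite _)
      rw [Set.ncard_union_eq (by
          rw [Set.disjoint_left]
          rintro x ⟨i, -, rfl⟩ ⟨v, -, h⟩
          cases h) (Set.toFinite _) (Set.toFinite _),
        Set.ncard_image_of_injective _ Sum.inr_injective,
        Set.ncard_image_of_injective _ Sum.inl_injective] at h
      simpa using h
    omega
  · exfalso
    push Not at hall
    obtain ⟨i, hi⟩ := hall
    have hall' : ∀ c : A.ConnectedComponent, c = A.connectedComponentMk ⟨_, hmem _ hi⟩ := by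
      intro c
      induction c using SimpleGraph.ConnectedComponent.ind with
      | h x =>
        apply SimpleGraph.ConnectedComponent.sound
        by_cases hx : x = ⟨Sum.inr i, hmem _ hi⟩
        · rw [hx]
        · apply SimpleGraph.Adj.reachable
          rw [hAadj]
          exact ⟨fun h => hx (Subtype.ext h), fun a b _ h => by cases h⟩
    have hsub : Subsingleton A.ConnectedComponent := ⟨fun a b => (hall' a).trans (hall' b).symm⟩
    have hle : A.oddComponents.ncard ≤ 1 := Set.ncard_le_one_of_subsingleton _
    have hu0 : u.ncard = 0 := by omega
    have ho1 : A.oddComponents.ncard = 1 := by omega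
    have hodd : Odd A.oddComponents.ncard := by rw [ho1]; exact odd_one
    rw [SimpleGraph.odd_ncard_oddComponents] at hodd
    have hue : u = ∅ := (Set.ncard_eq_zero (Set.toFinite _)).1 hu0
    have : Nat.card ((⊤ : (hyJoin G d).Subgraph).deleteVerts u).verts = Fintype.card V + d := by
      rw [Nat.card_coe_set_eq]
      simp [hue, Set.ncard_univ]
    rw [this] at hodd
    exact (Nat.not_odd_iff_even.2 hpar) hodd

lemma hy_berge {V : Type*} [Fintype V] (G : SimpleGraph V) :
    ∃ M : G.Subgraph, M.IsMatching ∧ ∃ S : Set V,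
      Fintype.card V + 2 * S.ncard ≤ 2 * M.edgeSet.ncard + 1 + (hyDel G S).oddComponents.ncard := by
  classical
  obtain ⟨M, hM, hmax⟩ := Set.exists_max_image {M : G.Subgraph | M.IsMatching}
    (fun M => M.verts.ncard) (Set.toFinite _) ⟨⊥, fun v hv => by simp at hv⟩
  refine ⟨M, hM, ?_⟩
  have hc := hy_matching_card (M := M) hM
  by_cases hn : Fintype.card V ≤ 2 * M.edgeSet.ncard + 1
  · exact ⟨∅, by simp; omega⟩
  · obtain ⟨d, hd⟩ : ∃ d, Fintype.card V = 2 * M.edgeSet.ncard + 2 + d :=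
      ⟨Fintype.card V - (2 * M.edgeSet.ncard + 2), by omega⟩
    have hno : ¬ ∃ P : (hyJoin G d).Subgraph, P.IsPerfectMatching := by
      rintro ⟨P, hP⟩
      obtain ⟨M', hM', h⟩ := hy_restrict G d P hP
      have := hmax M' hM'
      omega
    rw [SimpleGraph.tutte] at hno
    push Not at hno
    obtain ⟨u, hu⟩ := hno
    obtain ⟨S, hS⟩ := hy_violator G d ⟨M.edgeSet.ncard + 1 + d, by omega⟩ u hu
    exact ⟨S, by omega⟩

/-- (Henning–Yeo) For every odd `t ≥ 3`, every connected graph `G` with `n` vertices,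
`m` edges and maximum degree at most `t` contains a matching of size at least
`((t-1)/(t(t²-3)))·n + ((t²-t-2)/(t(t²-3)))·m - (t-1)/(t(t²-3))`. -/
theorem henning_yeo_odd {V : Type*} [Fintype V]
    (t : ℕ) (htodd : Odd t) (ht : 3 ≤ t)
    (G : SimpleGraph V) (hconn : G.Connected)
    (hdeg : ∀ v : V, (G.neighborSet v).ncard ≤ t) :
    ∃ M : G.Subgraph, M.IsMatching ∧
      ((t - 1 : ℝ) / (t * (t ^ 2 - 3))) * (Fintype.card V : ℝ) +
        ((t ^ 2 - t - 2 : ℝ) / (t * (t ^ 2 - 3))) * (G.edgeSet.ncard : ℝ) -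
        (t - 1 : ℝ) / (t * (t ^ 2 - 3)) ≤ (M.edgeSet.ncard : ℝ) := by
  classical
  obtain ⟨M, hM, S, hS⟩ := hy_berge G
  refine ⟨M, hM, ?_⟩
  have hle : hyDel G S ≤ G := fun _ _ h => h.1
  obtain ⟨F, hF1, hF2⟩ := hy_comp (hyDel G S) t htodd ht (fun v =>
    (Set.ncard_le_ncard (fun w hw => hle hw) (Set.toFinite _)).trans (hdeg v))
  have hE := hy_edges_S G S t hdeg
  have hK := hy_conn (H := hyDel G S) hconn
  have hm : (G.edgeSet \ (hyDel G S).edgeSet).ncard + (hyDel G S).edgeSet.ncard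
      = G.edgeSet.ncard :=
    Set.ncard_diff_add_ncard_of_subset (SimpleGraph.edgeSet_mono hle) (Set.toFinite _)
  have hnu : F + S.ncard ≤ M.edgeSet.ncard := by omega
  set E := (G.edgeSet \ (hyDel G S).edgeSet).ncard
  set m0 := (hyDel G S).edgeSet.ncard
  set K := Nat.card (hyDel G S).ConnectedComponent
  set n := Fintype.card V
  have hF2' : ((t : ℝ) - 1) * ((n : ℝ) - K) + ((t : ℝ) ^ 2 - t - 2) * m0
      ≤ (t : ℝ) * ((t : ℝ) ^ 2 - 3) * F := by exact_mod_cast hF2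
  have hE' : (E : ℝ) ≤ t * S.ncard := by exact_mod_cast hE
  have hK' : (K : ℝ) ≤ E + 1 := by exact_mod_cast hK
  have hm' : (E : ℝ) + m0 = G.edgeSet.ncard := by exact_mod_cast hm
  have hnu' : (F : ℝ) + S.ncard ≤ M.edgeSet.ncard := by exact_mod_cast hnu
  have ht' : (3 : ℝ) ≤ t := by exact_mod_cast ht
  have hpos : (0 : ℝ) < t ^ 2 - 3 := by nlinarith
  have hpos2 : (0 : ℝ) < t * (t ^ 2 - 3) := by positivity
  have h1 := mul_le_mul_of_nonneg_left hE' hpos.le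
  have h2 := mul_le_mul_of_nonneg_left hK' (by linarith : (0 : ℝ) ≤ t - 1)
  have h3 := mul_le_mul_of_nonneg_left hnu' hpos2.le
  rw [div_mul_eq_mul_div, div_mul_eq_mul_div, ← add_div, ← sub_div, div_le_iff₀ hpos2, ← hm']
  nlinarith
end
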